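/- For every countable model (M,𝒳) of IΣ2^0 there is a proper end extension (M,𝒳) ≼_{e,Σ2^0} (K,𝒳) (same second-order part, injected) such that for every Σ1^0 formula φ(z) with parameters from (K,𝒳) and every a ∈ M, the set {z < a : (K,𝒳) ⊨ φ(z)} is coded by an element of K. -/

import Mathlib

namespace PaperArith

/-! ## Syntax of (two-sorted) first-order arithmetic

Terms and formulas of arithmetic in the language `{0, 1, +, ·, <}`,
with number variables and (monadic second-order) set variables both indexed
by natural numbers.  Bounded quantifiers are taken as primitives, so that the
class `Δ₀` of bounded formulas is a purely syntactic class. -/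

/-- Terms of first-order arithmetic in the language `{0, 1, +, ·, <}`. -/
inductive Term : Type
  | var : ℕ → Term
  | zero : Term
  | one : Term
  | add : Term → Term → Term
  | mul : Term → Term → Term

/-- Formulas of (two-sorted) arithmetic.  `mem t i` is the atomic formula
`t ∈ Xᵢ`; `ball x t φ` is `∀ x < t, φ` and `bex x t φ` is `∃ x < t, φ`;
`sall i φ` and `sex i φ` quantify over the set variable `Xᵢ`.
Purely first-order formulas are those avoiding `mem`, `sall`, `sex`. -/
inductive Fml : Type
  | eq : Term → Term → Fml
  | lt : Term → Term → Fml
  | mem : Term → ℕ → Fml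
  | not : Fml → Fml
  | and : Fml → Fml → Fml
  | or : Fml → Fml → Fml
  | imp : Fml → Fml → Fml
  | all : ℕ → Fml → Fml
  | ex : ℕ → Fml → Fml
  | ball : ℕ → Term → Fml → Fml
  | bex : ℕ → Term → Fml → Fml
  | sall : ℕ → Fml → Fml
  | sex : ℕ → Fml → Fml

/-- A structure for the first-order language of arithmetic. -/
structure Str : Type 1 where
  M : Type
  zero : M
  one : M
  add : M → M → M
  mul : M → M → M
  lt : M → M → Prop

/-- Value of a term under a valuation of the number variables. -/
def tval (S : Str) (v : ℕ → S.M) : Term → S.M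
  | .var i => v i
  | .zero => S.zero
  | .one => S.one
  | .add t u => S.add (tval S v t) (tval S v u)
  | .mul t u => S.mul (tval S v t) (tval S v u)

/-- Update a valuation at one variable. -/
def upd {α : Type} (v : ℕ → α) (x : ℕ) (a : α) : ℕ → α :=
  fun i => if i = x then a else v i

/-- Tarskian satisfaction over the structure `S`, with second-order universe
`X` (set quantifiers range over `X`); `v` is the valuation of number
variables, `w` the valuation of set variables. -/
def Sat (S : Str) (X : Set (Set S.M)) : (ℕ → S.M) → (ℕ → Set S.M) → Fml → Prop
  | v, _, .eq t u => tval S v t = tval S v u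
  | v, _, .lt t u => S.lt (tval S v t) (tval S v u)
  | v, w, .mem t i => tval S v t ∈ w i
  | v, w, .not φ => ¬ Sat S X v w φ
  | v, w, .and φ ψ => Sat S X v w φ ∧ Sat S X v w ψ
  | v, w, .or φ ψ => Sat S X v w φ ∨ Sat S X v w ψ
  | v, w, .imp φ ψ => Sat S X v w φ → Sat S X v w ψ
  | v, w, .all x φ => ∀ m : S.M, Sat S X (upd v x m) w φ
  | v, w, .ex x φ => ∃ m : S.M, Sat S X (upd v x m) w φ
  | v, w, .ball x t φ => ∀ m : S.M, S.lt m (tval S v t) → Sat S X (upd v x m) w φ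
  | v, w, .bex x t φ => ∃ m : S.M, S.lt m (tval S v t) ∧ Sat S X (upd v x m) w φ
  | v, w, .sall i φ => ∀ A : Set S.M, A ∈ X → Sat S X v (upd w i A) φ
  | v, w, .sex i φ => ∃ A : Set S.M, A ∈ X ∧ Sat S X v (upd w i A) φ

/-- First-order satisfaction (for purely first-order formulas the second-order
data is irrelevant). -/
def Sat0 (S : Str) (v : ℕ → S.M) (φ : Fml) : Prop :=
  Sat S ∅ v (fun _ => ∅) φ

/-! ## The arithmetic hierarchy -/

/-- `Δ₀` formulas: purely first-order, only bounded quantifiers. -/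
inductive Delta0 : Fml → Prop
  | eq (t u : Term) : Delta0 (.eq t u)
  | lt (t u : Term) : Delta0 (.lt t u)
  | not {φ : Fml} : Delta0 φ → Delta0 (.not φ)
  | and {φ ψ : Fml} : Delta0 φ → Delta0 ψ → Delta0 (.and φ ψ)
  | or {φ ψ : Fml} : Delta0 φ → Delta0 ψ → Delta0 (.or φ ψ)
  | imp {φ ψ : Fml} : Delta0 φ → Delta0 ψ → Delta0 (.imp φ ψ)
  | ball (x : ℕ) (t : Term) {φ : Fml} : Delta0 φ → Delta0 (.ball x t φ)
  | bex (x : ℕ) (t : Term) {φ : Fml} : Delta0 φ → Delta0 (.bex x t φ)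

mutual
  /-- `Σₙ` formulas of the first-order arithmetic hierarchy. -/
  inductive IsSigma : ℕ → Fml → Prop
    | delta0 {n : ℕ} {φ : Fml} : Delta0 φ → IsSigma n φ
    | ofPi {n : ℕ} {φ : Fml} : IsPi n φ → IsSigma (n + 1) φ
    | ex (x : ℕ) {n : ℕ} {φ : Fml} : IsSigma (n + 1) φ → IsSigma (n + 1) (.ex x φ)
  /-- `Πₙ` formulas of the first-order arithmetic hierarchy. -/
  inductive IsPi : ℕ → Fml → Prop
    | delta0 {n : ℕ} {φ : Fml} : Delta0 φ → IsPi n φ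
    | ofSigma {n : ℕ} {φ : Fml} : IsSigma n φ → IsPi (n + 1) φ
    | all (x : ℕ) {n : ℕ} {φ : Fml} : IsPi (n + 1) φ → IsPi (n + 1) (.all x φ)
end

/-- `Σ₀(Σₙ)`: the closure of `Σₙ` under Boolean operations and bounded
quantification. -/
inductive Sigma0Sigma (n : ℕ) : Fml → Prop
  | ofSigma {φ : Fml} : IsSigma n φ → Sigma0Sigma n φ
  | not {φ : Fml} : Sigma0Sigma n φ → Sigma0Sigma n (.not φ)
  | and {φ ψ : Fml} : Sigma0Sigma n φ → Sigma0Sigma n ψ → Sigma0Sigma n (.and φ ψ)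
  | or {φ ψ : Fml} : Sigma0Sigma n φ → Sigma0Sigma n ψ → Sigma0Sigma n (.or φ ψ)
  | imp {φ ψ : Fml} : Sigma0Sigma n φ → Sigma0Sigma n ψ → Sigma0Sigma n (.imp φ ψ)
  | ball (x : ℕ) (t : Term) {φ : Fml} : Sigma0Sigma n φ → Sigma0Sigma n (.ball x t φ)
  | bex (x : ℕ) (t : Term) {φ : Fml} : Sigma0Sigma n φ → Sigma0Sigma n (.bex x t φ)

/-- The class `Σₙ ∧ Πₙ` of conjunctions of a `Σₙ` and a `Πₙ` formula. -/
def SigmaAndPi (n : ℕ) (φ : Fml) : Prop :=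
  ∃ ψ χ : Fml, IsSigma n ψ ∧ IsPi n χ ∧ φ = Fml.and ψ χ

/-- The class `Σₙ ∨ Πₙ` of disjunctions of a `Σₙ` and a `Πₙ` formula. -/
def SigmaOrPi (n : ℕ) (φ : Fml) : Prop :=
  ∃ ψ χ : Fml, IsSigma n ψ ∧ IsPi n χ ∧ φ = Fml.or ψ χ

/-- `Δ₀⁰` formulas of second-order arithmetic: only bounded first-order
quantifiers; free set variables (set parameters) are allowed. -/
inductive Delta0SO : Fml → Prop
  | eq (t u : Term) : Delta0SO (.eq t u)
  | lt (t u : Term) : Delta0SO (.lt t u)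
  | mem (t : Term) (i : ℕ) : Delta0SO (.mem t i)
  | not {φ : Fml} : Delta0SO φ → Delta0SO (.not φ)
  | and {φ ψ : Fml} : Delta0SO φ → Delta0SO ψ → Delta0SO (.and φ ψ)
  | or {φ ψ : Fml} : Delta0SO φ → Delta0SO ψ → Delta0SO (.or φ ψ)
  | imp {φ ψ : Fml} : Delta0SO φ → Delta0SO ψ → Delta0SO (.imp φ ψ)
  | ball (x : ℕ) (t : Term) {φ : Fml} : Delta0SO φ → Delta0SO (.ball x t φ)
  | bex (x : ℕ) (t : Term) {φ : Fml} : Delta0SO φ → Delta0SO (.bex x t φ)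

mutual
  /-- `Σₙ⁰` formulas of the second-order arithmetic hierarchy
  (set parameters allowed, no set quantifiers). -/
  inductive SigmaSO : ℕ → Fml → Prop
    | delta0 {n : ℕ} {φ : Fml} : Delta0SO φ → SigmaSO n φ
    | ofPi {n : ℕ} {φ : Fml} : PiSO n φ → SigmaSO (n + 1) φ
    | ex (x : ℕ) {n : ℕ} {φ : Fml} : SigmaSO (n + 1) φ → SigmaSO (n + 1) (.ex x φ)
  /-- `Πₙ⁰` formulas of the second-order arithmetic hierarchy. -/
  inductive PiSO : ℕ → Fml → Prop
    | delta0 {n : ℕ} {φ : Fml} : Delta0SO φ → PiSO n φ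
    | ofSigma {n : ℕ} {φ : Fml} : SigmaSO n φ → PiSO (n + 1) φ
    | all (x : ℕ) {n : ℕ} {φ : Fml} : PiSO (n + 1) φ → PiSO (n + 1) (.all x φ)
end

/-! ## First-order theories -/

/-- `PA⁻`: the theory of non-negative parts of discretely ordered rings. -/
structure PAminus (S : Str) : Prop where
  add_assoc : ∀ a b c, S.add (S.add a b) c = S.add a (S.add b c)
  add_comm : ∀ a b, S.add a b = S.add b a
  mul_assoc : ∀ a b c, S.mul (S.mul a b) c = S.mul a (S.mul b c)
  mul_comm : ∀ a b, S.mul a b = S.mul b a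
  distrib : ∀ a b c, S.mul a (S.add b c) = S.add (S.mul a b) (S.mul a c)
  add_zero : ∀ a, S.add a S.zero = a
  mul_zero : ∀ a, S.mul a S.zero = S.zero
  mul_one : ∀ a, S.mul a S.one = a
  lt_irrefl : ∀ a, ¬ S.lt a a
  lt_trans : ∀ a b c, S.lt a b → S.lt b c → S.lt a c
  lt_total : ∀ a b, S.lt a b ∨ a = b ∨ S.lt b a
  add_lt_add : ∀ a b c, S.lt a b → S.lt (S.add a c) (S.add b c)
  mul_lt_mul : ∀ a b c, S.lt a b → S.lt S.zero c → S.lt (S.mul a c) (S.mul b c)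
  zero_lt_one : S.lt S.zero S.one
  zero_le : ∀ a, a = S.zero ∨ S.lt S.zero a
  discrete : ∀ a b, S.lt a b → S.add a S.one = b ∨ S.lt (S.add a S.one) b
  pred : ∀ a, S.lt S.zero a → ∃ b, S.add b S.one = a
  sub : ∀ a b, S.lt a b → ∃ c, S.add a c = b

/-- The induction scheme for the class `Γ` of formulas
(parameters are allowed via the ambient valuation `v`). -/
def IndFor (S : Str) (Γ : Fml → Prop) : Prop :=
  ∀ φ : Fml, Γ φ → ∀ (v : ℕ → S.M) (x : ℕ),
    Sat0 S (upd v x S.zero) φ →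
    (∀ m, Sat0 S (upd v x m) φ → Sat0 S (upd v x (S.add m S.one)) φ) →
    ∀ m, Sat0 S (upd v x m) φ

/-- The collection scheme for the class `Γ`:
`(∀ x < a ∃ y φ) → (∃ b ∀ x < a ∃ y < b φ)`. -/
def CollFor (S : Str) (Γ : Fml → Prop) : Prop :=
  ∀ φ : Fml, Γ φ → ∀ (v : ℕ → S.M) (x y : ℕ), x ≠ y → ∀ a : S.M,
    (∀ m, S.lt m a → ∃ k, Sat0 S (upd (upd v x m) y k) φ) →
    ∃ b, ∀ m, S.lt m a → ∃ k, S.lt k b ∧ Sat0 S (upd (upd v x m) y k) φ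

/-- `IΔ₀` (over `PA⁻`). -/
def IDelta0 (S : Str) : Prop := PAminus S ∧ IndFor S Delta0

/-- `IΣₙ` (over `PA⁻`; note `Δ₀ ⊆ Σₙ`, so this includes `IΔ₀`). -/
def ISigma (S : Str) (n : ℕ) : Prop := PAminus S ∧ IndFor S (IsSigma n)

/-- `BΣₙ`: the `Σₙ`-collection scheme, including `IΔ₀` (over `PA⁻`). -/
def BSigma (S : Str) (n : ℕ) : Prop := IDelta0 S ∧ CollFor S (IsSigma n)

/-- The weak regularity principle `WRφ` for all `φ` in the class `Γ`:
the universal closure of `(∀ x ∃ y < a φ(x,y)) → (∃ y < a ∀ b ∃ x > b φ(x,y))`.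
Here `x, y` are the two displayed variables and all other free variables of
`φ` are parameters, interpreted by the ambient valuation `v`. -/
def WRFor (S : Str) (Γ : Fml → Prop) : Prop :=
  ∀ φ : Fml, Γ φ → ∀ (v : ℕ → S.M) (x y : ℕ), x ≠ y → ∀ a : S.M,
    (∀ m, ∃ k, S.lt k a ∧ Sat0 S (upd (upd v x m) y k) φ) →
    ∃ k, S.lt k a ∧ ∀ b, ∃ m, S.lt b m ∧ Sat0 S (upd (upd v x m) y k) φ

/-! ## Second-order theories -/

/-- Second-order induction scheme for the class `Γ`, with set parameters
from the second-order universe `X`. -/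
def IndForSO (S : Str) (X : Set (Set S.M)) (Γ : Fml → Prop) : Prop :=
  ∀ φ : Fml, Γ φ → ∀ (v : ℕ → S.M) (w : ℕ → Set S.M), (∀ i, w i ∈ X) → ∀ x : ℕ,
    Sat S X (upd v x S.zero) w φ →
    (∀ m, Sat S X (upd v x m) w φ → Sat S X (upd v x (S.add m S.one)) w φ) →
    ∀ m, Sat S X (upd v x m) w φ

/-- Second-order collection scheme for the class `Γ`. -/
def CollForSO (S : Str) (X : Set (Set S.M)) (Γ : Fml → Prop) : Prop :=
  ∀ φ : Fml, Γ φ → ∀ (v : ℕ → S.M) (w : ℕ → Set S.M), (∀ i, w i ∈ X) →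
    ∀ (x y : ℕ), x ≠ y → ∀ a : S.M,
    (∀ m, S.lt m a → ∃ k, Sat S X (upd (upd v x m) y k) w φ) →
    ∃ b, ∀ m, S.lt m a → ∃ k, S.lt k b ∧ Sat S X (upd (upd v x m) y k) w φ

/-- `Δ₁⁰`-comprehension. -/
def Delta1CA (S : Str) (X : Set (Set S.M)) : Prop :=
  ∀ φ ψ : Fml, SigmaSO 1 φ → PiSO 1 ψ →
    ∀ (v : ℕ → S.M) (w : ℕ → Set S.M), (∀ i, w i ∈ X) → ∀ x : ℕ,
    (∀ m, Sat S X (upd v x m) w φ ↔ Sat S X (upd v x m) w ψ) →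
    ∃ A ∈ X, ∀ m, m ∈ A ↔ Sat S X (upd v x m) w φ

/-- `Σₙ`-comprehension for first-order formulas with parameters from `M`. -/
def SigmaCA (S : Str) (X : Set (Set S.M)) (n : ℕ) : Prop :=
  ∀ φ : Fml, IsSigma n φ → ∀ (v : ℕ → S.M) (x : ℕ),
    ∃ A ∈ X, ∀ m, m ∈ A ↔ Sat0 S (upd v x m) φ

/-- `RCA₀`. -/
def RCA0 (S : Str) (X : Set (Set S.M)) : Prop :=
  PAminus S ∧ IndForSO S X (SigmaSO 1) ∧ Delta1CA S X

/-- `Σ₁⁰`-separation; over `RCA₀` this is equivalent to weak Kőnig's lemma. -/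
def Sigma1Sep (S : Str) (X : Set (Set S.M)) : Prop :=
  ∀ φ ψ : Fml, SigmaSO 1 φ → SigmaSO 1 ψ →
    ∀ (v : ℕ → S.M) (w : ℕ → Set S.M), (∀ i, w i ∈ X) → ∀ x : ℕ,
    (∀ m, ¬ (Sat S X (upd v x m) w φ ∧ Sat S X (upd v x m) w ψ)) →
    ∃ A ∈ X, ∀ m, (Sat S X (upd v x m) w φ → m ∈ A) ∧ (m ∈ A → ¬ Sat S X (upd v x m) w ψ)

/-- `WKL₀`, rendered as `RCA₀` plus `Σ₁⁰`-separation (which is equivalent,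
over `RCA₀`, to weak Kőnig's lemma). -/
def WKL0 (S : Str) (X : Set (Set S.M)) : Prop := RCA0 S X ∧ Sigma1Sep S X

/-- `BΣₙ⁰`: the second-order `Σₙ⁰`-collection scheme (including `IΔ₀⁰`,
over `PA⁻`). -/
def BSigmaSO (S : Str) (X : Set (Set S.M)) (n : ℕ) : Prop :=
  PAminus S ∧ IndForSO S X Delta0SO ∧ CollForSO S X (SigmaSO n)

/-- `IΣₙ⁰`: the second-order `Σₙ⁰`-induction scheme, over `RCA₀`. -/
def ISigmaSO (S : Str) (X : Set (Set S.M)) (n : ℕ) : Prop :=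
  RCA0 S X ∧ IndForSO S X (SigmaSO n)

/-! ## Exponentiation and binary digits -/

/-- Satisfaction of a three-variable formula `E(x₀, x₁, x₂)` at `(a, b, c)`. -/
def ExpAt (S : Str) (E : Fml) (a b c : S.M) : Prop :=
  Sat0 S (fun i => if i = 0 then a else if i = 1 then b else c) E

/-- `E(x₀,x₁,x₂)` is a `Δ₀` definition of the (total) exponentiation function
`x₀ ^ x₁ = x₂`.  The existence of such an `E` expresses `exp`
(the totality of exponentiation). -/
structure IsExpDef (S : Str) (E : Fml) : Prop where
  delta0 : Delta0 E
  base : ∀ a, ExpAt S E a S.zero S.one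
  total : ∀ a b, ∃ c, ExpAt S E a b c
  unique : ∀ a b c c', ExpAt S E a b c → ExpAt S E a b c' → c = c'
  step : ∀ a b c, ExpAt S E a b c → ExpAt S E a (S.add b S.one) (S.mul c a)

/-- `exp`: the totality of exponentiation (via a `Δ₀` definition of its
graph). -/
def SatExp (S : Str) : Prop := ∃ E : Fml, IsExpDef S E

/-! ## Embeddings, end extensions and elementarity -/

/-- An embedding of arithmetic structures. -/
structure Emb (S K : Str) where
  j : S.M → K.M
  inj : Function.Injective j
  zero : j S.zero = K.zero
  one : j S.one = K.one
  add : ∀ a b, j (S.add a b) = K.add (j a) (j b)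
  mul : ∀ a b, j (S.mul a b) = K.mul (j a) (j b)
  lt_iff : ∀ a b, S.lt a b ↔ K.lt (j a) (j b)

/-- The extension along `e` is an end extension: every element of `K` not in
the image of `M` exceeds every element of `M`. -/
def IsEndExt {S K : Str} (e : Emb S K) : Prop :=
  ∀ b : K.M, b ∉ Set.range e.j → ∀ a : S.M, K.lt (e.j a) b

/-- The extension along `e` is proper. -/
def IsProper {S K : Str} (e : Emb S K) : Prop := ¬ Function.Surjective e.j

/-- The extension along `e` is `Σₙ`-elementary: all `Σₙ` formulas with
parameters from `M` are absolute between `M` and `K`. -/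
def SigmaElem {S K : Str} (e : Emb S K) (n : ℕ) : Prop :=
  ∀ φ : Fml, IsSigma n φ → ∀ v : ℕ → S.M,
    (Sat0 S v φ ↔ Sat0 K (fun i => e.j (v i)) φ)

/-- `K ⊨ M‑IΣₙ` (for an extension `e : M → K`): induction up to any `a ∈ M`
for `Σₙ` formulas with parameters from `K`. -/
def MISigma {S K : Str} (e : Emb S K) (n : ℕ) : Prop :=
  ∀ φ : Fml, IsSigma n φ → ∀ (v : ℕ → K.M) (x : ℕ) (a : S.M),
    Sat0 K (upd v x K.zero) φ →
    (∀ m, K.lt m (e.j a) → (Sat0 K (upd v x m) φ → Sat0 K (upd v x (K.add m K.one)) φ)) →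
    ∀ m, K.lt m (e.j a) → Sat0 K (upd v x m) φ

/-- The `x`-th binary digit of `c ∈ K` is `1`, computed via a `Δ₀` definition
`E` of exponentiation on the ground model `S` (here `x` lies under the image
of `S`): there are `x', p ∈ M` with `j x' = x`, `p = 2 ^ x'`, and `u, v ∈ K`
with `c = u·(2p) + p + v` and `v < p`. -/
def BitVia {S K : Str} (e : Emb S K) (E : Fml) (x c : K.M) : Prop :=
  ∃ x' p : S.M, e.j x' = x ∧ ExpAt S E (S.add S.one S.one) x' p ∧
    ∃ u v : K.M, K.lt v (e.j p) ∧
      c = K.add (K.add (K.mul u (K.add (e.j p) (e.j p))) (e.j p)) v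

/-! ## The second-order restricted ultrapower -/

/-- `A` is cofinal (unbounded) in `S`. -/
def Cofinal (S : Str) (A : Set S.M) : Prop := ∀ b : S.M, ∃ x ∈ A, S.lt b x

/-- The pairing term `⟨x, y⟩ = (x + y)·(x + y) + x`. -/
def pairS (S : Str) (x y : S.M) : S.M := S.add (S.mul (S.add x y) (S.add x y)) x

/-- The graph of `f : M → M`, coded as a subset of `M` via pairing. -/
def graphOf (S : Str) (f : S.M → S.M) : Set S.M := {m | ∃ x, m = pairS S x (f x)}

/-- `f` is a total function `M → M` lying in the second-order universe `X`
(its coded graph belongs to `X`).  The collection of such `f` is the class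
`ℱ` of the restricted ultrapower. -/
def FuncIn (S : Str) (X : Set (Set S.M)) (f : S.M → S.M) : Prop := graphOf S f ∈ X

/-- `U` is an ultrafilter on the Boolean algebra `X`, all of whose elements
are cofinal in `M`. -/
structure UltraOn (S : Str) (X U : Set (Set S.M)) : Prop where
  subset : U ⊆ X
  univ_mem : Set.univ ∈ U
  empty_not_mem : ∅ ∉ U
  inter_mem : ∀ A ∈ U, ∀ B ∈ U, A ∩ B ∈ U
  superset_mem : ∀ A ∈ U, ∀ B ∈ X, A ⊆ B → B ∈ U
  ultra : ∀ A ∈ X, A ∈ U ∨ Aᶜ ∈ U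
  cofinal : ∀ A ∈ U, Cofinal S A

/-- A realization of the second-order restricted ultrapower `ℱ/𝒰` of `S`
with respect to the second-order universe `X` and the ultrafilter `U`:
a structure `K` whose elements are exactly the classes `cls f hf = [f]` of
total functions `f ∈ ℱ`, where `[f] = [g]` iff `f = g` on a set in `U`, with
pointwise arithmetic operations, order decided by `U`, and the inherited
second-order membership relation `memK` serving as the second-order expansion. -/
structure RUP (S : Str) (X U : Set (Set S.M)) : Type 1 where
  K : Str
  cls : (f : S.M → S.M) → FuncIn S X f → K.M
  memK : K.M → Set S.M → Prop
  const_in : ∀ a : S.M, FuncIn S X (fun _ => a)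
  surj : ∀ b : K.M, ∃ (f : S.M → S.M) (hf : FuncIn S X f), cls f hf = b
  eq_iff : ∀ (f : S.M → S.M) (hf : FuncIn S X f) (g : S.M → S.M) (hg : FuncIn S X g),
      (cls f hf = cls g hg) ↔ {i : S.M | f i = g i} ∈ U
  lt_iff : ∀ (f : S.M → S.M) (hf : FuncIn S X f) (g : S.M → S.M) (hg : FuncIn S X g),
      K.lt (cls f hf) (cls g hg) ↔ {i : S.M | S.lt (f i) (g i)} ∈ U
  zero_eq : K.zero = cls (fun _ => S.zero) (const_in S.zero)
  one_eq : K.one = cls (fun _ => S.one) (const_in S.one)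
  add_eq : ∀ (f : S.M → S.M) (hf : FuncIn S X f) (g : S.M → S.M) (hg : FuncIn S X g)
      (h : S.M → S.M) (hh : FuncIn S X h), (∀ i, h i = S.add (f i) (g i)) →
      K.add (cls f hf) (cls g hg) = cls h hh
  mul_eq : ∀ (f : S.M → S.M) (hf : FuncIn S X f) (g : S.M → S.M) (hg : FuncIn S X g)
      (h : S.M → S.M) (hh : FuncIn S X h), (∀ i, h i = S.mul (f i) (g i)) →
      K.mul (cls f hf) (cls g hg) = cls h hh
  mem_iff : ∀ (f : S.M → S.M) (hf : FuncIn S X f) (A : Set S.M), A ∈ X →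
      (memK (cls f hf) A ↔ {i : S.M | f i ∈ A} ∈ U)

/-- The canonical embedding `M → ℱ/𝒰` via constant functions. -/
def RUP.emb {S : Str} {X U : Set (Set S.M)} (R : RUP S X U) (a : S.M) : R.K.M :=
  R.cls (fun _ => a) (R.const_in a)

/-- The subset of `ℱ/𝒰` induced by `A ⊆ M`. -/
def RUP.setImg {S : Str} {X U : Set (Set S.M)} (R : RUP S X U) (A : Set S.M) :
    Set R.K.M := {b | R.memK b A}

/-- The second-order part of the expanded ultrapower `(ℱ/𝒰, 𝒳)`:
the (injected) copy of `X`. -/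
def RUP.X2 {S : Str} {X U : Set (Set S.M)} (R : RUP S X U) : Set (Set R.K.M) :=
  (fun A => R.setImg A) '' X

end PaperArith

namespace PaperArith

/-! ## Renaming of variables -/

/-- Renaming of the number variables of a term. -/
def Term.rename (ρ : ℕ → ℕ) : Term → Term
  | .var i => .var (ρ i)
  | .zero => .zero
  | .one => .one
  | .add t u => .add (t.rename ρ) (u.rename ρ)
  | .mul t u => .mul (t.rename ρ) (u.rename ρ)

/-- Renaming of all number variables by `ρ` and of all set variables by `σ`. -/
def Fml.rename (ρ σ : ℕ → ℕ) : Fml → Fml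
  | .eq t u => .eq (t.rename ρ) (u.rename ρ)
  | .lt t u => .lt (t.rename ρ) (u.rename ρ)
  | .mem t i => .mem (t.rename ρ) (σ i)
  | .not φ => .not (φ.rename ρ σ)
  | .and φ ψ => .and (φ.rename ρ σ) (ψ.rename ρ σ)
  | .or φ ψ => .or (φ.rename ρ σ) (ψ.rename ρ σ)
  | .imp φ ψ => .imp (φ.rename ρ σ) (ψ.rename ρ σ)
  | .all x φ => .all (ρ x) (φ.rename ρ σ)
  | .ex x φ => .ex (ρ x) (φ.rename ρ σ)
  | .ball x t φ => .ball (ρ x) (t.rename ρ) (φ.rename ρ σ)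
  | .bex x t φ => .bex (ρ x) (t.rename ρ) (φ.rename ρ σ)
  | .sall i φ => .sall (σ i) (φ.rename ρ σ)
  | .sex i φ => .sex (σ i) (φ.rename ρ σ)

theorem tval_rename (S : Str) (v : ℕ → S.M) (ρ : ℕ → ℕ) (t : Term) :
    tval S v (t.rename ρ) = tval S (fun i => v (ρ i)) t := by
  induction t with
  | var i => rfl
  | zero => rfl
  | one => rfl
  | add t u iht ihu => simp only [Term.rename, tval, iht, ihu]
  | mul t u iht ihu => simp only [Term.rename, tval, iht, ihu]

theorem upd_comp {α : Type} {ρ : ℕ → ℕ} (hρ : Function.Injective ρ) (v : ℕ → α) (x : ℕ) (a : α) :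
    (fun i => upd v (ρ x) a (ρ i)) = upd (fun i => v (ρ i)) x a := by
  funext i
  simp only [upd, hρ.eq_iff]

theorem Delta0SO.rename {φ : Fml} (h : Delta0SO φ) (ρ σ : ℕ → ℕ) : Delta0SO (φ.rename ρ σ) := by
  induction h with
  | eq t u => exact .eq _ _
  | lt t u => exact .lt _ _
  | mem t i => exact .mem _ _
  | not _ ih => exact .not ih
  | and _ _ ih ih' => exact .and ih ih'
  | or _ _ ih ih' => exact .or ih ih'
  | imp _ _ ih ih' => exact .imp ih ih'
  | ball x t _ ih => exact .ball _ _ ih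
  | bex x t _ ih => exact .bex _ _ ih

theorem PiSO.rename {φ : Fml} (h : PiSO 1 φ) (ρ σ : ℕ → ℕ) :
    PiSO 1 (φ.rename ρ σ) := by
  induction φ with
  | all x φ ih =>
    cases h with
    | delta0 h => exact .delta0 (h.rename ρ σ)
    | ofSigma h => cases h with | delta0 h => exact .delta0 (h.rename ρ σ)
    | all _ h => exact .all _ (ih h)
  | _ =>
    cases h with
    | delta0 h => exact .delta0 (h.rename ρ σ)
    | ofSigma h => cases h with | delta0 h => exact .delta0 (h.rename ρ σ)

/-- Formulas without set quantifiers. -/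
def Fml.NoSetQuant : Fml → Prop
  | .eq _ _ => True
  | .lt _ _ => True
  | .mem _ _ => True
  | .not φ => φ.NoSetQuant
  | .and φ ψ => φ.NoSetQuant ∧ ψ.NoSetQuant
  | .or φ ψ => φ.NoSetQuant ∧ ψ.NoSetQuant
  | .imp φ ψ => φ.NoSetQuant ∧ ψ.NoSetQuant
  | .all _ φ => φ.NoSetQuant
  | .ex _ φ => φ.NoSetQuant
  | .ball _ _ φ => φ.NoSetQuant
  | .bex _ _ φ => φ.NoSetQuant
  | .sall _ _ => False
  | .sex _ _ => False

theorem Delta0SO.noSetQuant {φ : Fml} (h : Delta0SO φ) : φ.NoSetQuant := by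
  induction h <;> simp_all [Fml.NoSetQuant]

theorem sat_rename (S : Str) (X : Set (Set S.M)) {ρ : ℕ → ℕ} (hρ : Function.Injective ρ)
    (σ : ℕ → ℕ) (w : ℕ → Set S.M) {φ : Fml} (h : φ.NoSetQuant) (v : ℕ → S.M) :
    Sat S X v w (φ.rename ρ σ) ↔ Sat S X (fun i => v (ρ i)) (fun i => w (σ i)) φ := by
  induction φ generalizing v with
  | eq t u => simp only [Fml.rename, Sat, tval_rename]
  | lt t u => simp only [Fml.rename, Sat, tval_rename]
  | mem t i => simp only [Fml.rename, Sat, tval_rename]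
  | not φ ih => simp only [Fml.rename, Sat, ih h]
  | and φ ψ ih ih' => simp only [Fml.rename, Sat, ih h.1, ih' h.2]
  | or φ ψ ih ih' => simp only [Fml.rename, Sat, ih h.1, ih' h.2]
  | imp φ ψ ih ih' => simp only [Fml.rename, Sat, ih h.1, ih' h.2]
  | all x φ ih => simp only [Fml.rename, Sat, ih h, upd_comp hρ]
  | ex x φ ih => simp only [Fml.rename, Sat, ih h, upd_comp hρ]
  | ball x t φ ih => simp only [Fml.rename, Sat, ih h, upd_comp hρ, tval_rename]
  | bex x t φ ih => simp only [Fml.rename, Sat, ih h, upd_comp hρ, tval_rename]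
  | sall i φ _ => exact h.elim
  | sex i φ _ => exact h.elim

theorem Delta0.delta0SO {φ : Fml} (h : Delta0 φ) : Delta0SO φ := by
  induction h with
  | eq t u => exact .eq _ _
  | lt t u => exact .lt _ _
  | not _ ih => exact .not ih
  | and _ _ ih ih' => exact .and ih ih'
  | or _ _ ih ih' => exact .or ih ih'
  | imp _ _ ih ih' => exact .imp ih ih'
  | ball x t _ ih => exact .ball _ _ ih
  | bex x t _ ih => exact .bex _ _ ih

theorem Delta0.sat0_iff {S : Str} {φ : Fml} (h : Delta0 φ) (X : Set (Set S.M))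
    (w : ℕ → Set S.M) (v : ℕ → S.M) : Sat0 S v φ ↔ Sat S X v w φ := by
  unfold Sat0
  induction h generalizing v <;> simp_all only [Sat]

/-! ## Countability of the set of formulas -/

/-- A numerical code of a term. -/
def Term.code : Term → ℕ
  | .var i => Nat.pair 0 i
  | .zero => Nat.pair 1 0
  | .one => Nat.pair 2 0
  | .add t u => Nat.pair 3 (Nat.pair t.code u.code)
  | .mul t u => Nat.pair 4 (Nat.pair t.code u.code)

theorem Term.code_injective : Function.Injective Term.code := by
  intro t
  induction t with
  | add t u iht ihu =>
    intro s h
    cases s <;> simp only [Term.code, Nat.pair_eq_pair] at h <;> try omega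
    rw [iht h.2.1, ihu h.2.2]
  | mul t u iht ihu =>
    intro s h
    cases s <;> simp only [Term.code, Nat.pair_eq_pair] at h <;> try omega
    rw [iht h.2.1, ihu h.2.2]
  | _ =>
    intro s h
    cases s <;> simp_all [Term.code]

/-- A numerical code of a formula. -/
def Fml.code : Fml → ℕ
  | .eq t u => Nat.pair 0 (Nat.pair t.code u.code)
  | .lt t u => Nat.pair 1 (Nat.pair t.code u.code)
  | .mem t i => Nat.pair 2 (Nat.pair t.code i)
  | .not φ => Nat.pair 3 φ.code
  | .and φ ψ => Nat.pair 4 (Nat.pair φ.code ψ.code)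
  | .or φ ψ => Nat.pair 5 (Nat.pair φ.code ψ.code)
  | .imp φ ψ => Nat.pair 6 (Nat.pair φ.code ψ.code)
  | .all x φ => Nat.pair 7 (Nat.pair x φ.code)
  | .ex x φ => Nat.pair 8 (Nat.pair x φ.code)
  | .ball x t φ => Nat.pair 9 (Nat.pair x (Nat.pair t.code φ.code))
  | .bex x t φ => Nat.pair 10 (Nat.pair x (Nat.pair t.code φ.code))
  | .sall i φ => Nat.pair 11 (Nat.pair i φ.code)
  | .sex i φ => Nat.pair 12 (Nat.pair i φ.code)

theorem Fml.code_injective : Function.Injective Fml.code := by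
  intro φ
  induction φ <;> intro ψ h <;> cases ψ <;>
    simp only [Fml.code, Nat.pair_eq_pair, Term.code_injective.eq_iff] at h <;>
    first
    | omega
    | grind

instance : Countable Fml := Fml.code_injective.countable

/-! ## Countable models -/

/-- A countable model of second-order arithmetic with `Σ₂⁰`-induction, together with enumerations
of both of its sorts. -/
structure Model where
  S : Str
  X : Set (Set S.M)
  pa : PAminus S
  ind₁ : IndForSO S X (SigmaSO 1)
  ca : Delta1CA S X
  ind₂ : IndForSO S X (SigmaSO 2)
  num : ℕ → S.M
  num_surjective : Function.Surjective num
  sets : ℕ → Set S.M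
  sets_mem : ∀ i, sets i ∈ X
  sets_surjective : ∀ A ∈ X, ∃ i, sets i = A

section Order

variable {T : Model}

instance : Add T.S.M := ⟨T.S.add⟩

instance : Mul T.S.M := ⟨T.S.mul⟩

instance : Zero T.S.M := ⟨T.S.zero⟩

instance : One T.S.M := ⟨T.S.one⟩

noncomputable instance : CommSemiring T.S.M where
  nsmul := nsmulRec
  add_assoc := T.pa.add_assoc
  add_comm := T.pa.add_comm
  zero_add a := (T.pa.add_comm _ _).trans (T.pa.add_zero a)
  add_zero := T.pa.add_zero
  mul_assoc := T.pa.mul_assoc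
  mul_comm := T.pa.mul_comm
  one_mul a := (T.pa.mul_comm _ _).trans (T.pa.mul_one a)
  mul_one := T.pa.mul_one
  mul_zero := T.pa.mul_zero
  zero_mul a := (T.pa.mul_comm _ _).trans (T.pa.mul_zero a)
  left_distrib := T.pa.distrib
  right_distrib a b c := by
    change T.S.mul (T.S.add a b) c = T.S.add (T.S.mul a c) (T.S.mul b c)
    rw [T.pa.mul_comm, T.pa.distrib, T.pa.mul_comm c a, T.pa.mul_comm c b]

noncomputable instance : LinearOrder T.S.M where
  le a b := a = b ∨ T.S.lt a b
  lt := T.S.lt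
  le_refl a := Or.inl rfl
  le_trans a b c := by
    rintro (rfl | h) (rfl | h')
    · exact Or.inl rfl
    · exact Or.inr h'
    · exact Or.inr h
    · exact Or.inr (T.pa.lt_trans _ _ _ h h')
  lt_iff_le_not_ge a b := by
    constructor
    · intro h
      refine ⟨Or.inr h, ?_⟩
      rintro (rfl | h')
      · exact T.pa.lt_irrefl _ h
      · exact T.pa.lt_irrefl _ (T.pa.lt_trans _ _ _ h h')
    · rintro ⟨rfl | h, h'⟩
      · exact absurd (Or.inl rfl) h'
      · exact h
  le_antisymm a b := by
    rintro (rfl | h) (h' | h')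
    · rfl
    · rfl
    · exact h'.symm
    · exact absurd (T.pa.lt_trans _ _ _ h h') (T.pa.lt_irrefl _)
  le_total a b := by
    rcases T.pa.lt_total a b with h | h | h
    · exact Or.inl (Or.inr h)
    · exact Or.inl (Or.inl h)
    · exact Or.inr (Or.inr h)
  toDecidableLE := Classical.decRel _

theorem Model.add_lt_add_right' {a b : T.S.M} (h : a < b) (c : T.S.M) : a + c < b + c :=
  T.pa.add_lt_add a b c h

instance : IsStrictOrderedRing T.S.M where
  add_le_add_left a b h c := by
    rcases h with rfl | h
    · exact le_rfl
    · exact (Model.add_lt_add_right' h c).le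
  le_of_add_le_add_left a b c h := by
    by_contra hlt
    rw [not_le] at hlt
    have := Model.add_lt_add_right' hlt a
    rw [add_comm c, add_comm b] at this
    exact absurd h this.not_ge
  zero_le_one := (show (0 : T.S.M) < 1 from T.pa.zero_lt_one).le
  exists_pair_ne := ⟨0, 1, (show (0 : T.S.M) < 1 from T.pa.zero_lt_one).ne⟩
  mul_lt_mul_of_pos_left a h b c hbc := by
    have := T.pa.mul_lt_mul b c a hbc h
    rw [T.pa.mul_comm b, T.pa.mul_comm c] at this
    exact this
  mul_lt_mul_of_pos_right a h b c hbc := T.pa.mul_lt_mul b c a hbc h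

instance : CanonicallyOrderedAdd T.S.M where
  exists_add_of_le {a b} h := by
    rcases h with rfl | h
    · exact ⟨0, (add_zero _).symm⟩
    · obtain ⟨c, hc⟩ := T.pa.sub _ _ h
      exact ⟨c, hc.symm⟩
  le_add_self a b := by
    have : (0 : T.S.M) ≤ b := (T.pa.zero_le b).imp Eq.symm id
    simpa using add_le_add_left this a
  le_self_add a b := by
    have : (0 : T.S.M) ≤ b := (T.pa.zero_le b).imp Eq.symm id
    simpa using add_le_add_right this a

theorem Model.lt_add_one_iff {a b : T.S.M} : a < b + 1 ↔ a ≤ b := by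
  constructor
  · intro h
    by_contra hlt
    rw [not_le] at hlt
    rcases T.pa.discrete _ _ hlt with h' | h'
    · exact absurd h (show b + 1 = a from h').le.not_gt
    · exact absurd h (show b + 1 < a from h').not_gt
  · intro h
    exact h.trans_lt (lt_add_of_pos_right b zero_lt_one)

theorem Model.add_one_le_iff {a b : T.S.M} : a + 1 ≤ b ↔ a < b := by
  rw [← not_lt, Model.lt_add_one_iff, not_le]

end Order

/-! ## Contexts and representability -/

/-- Extend a context by a new innermost variable. -/
def push {α : Type} (a : α) (x : ℕ → α) : ℕ → α
  | 0 => a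
  | k + 1 => x k

/-- The variables of a formula split into three kinds: names of constants, variables of the
context, and variables reserved for quantification. -/
noncomputable def varEquiv : ℕ ⊕ ℕ ⊕ ℕ ≃ ℕ := Denumerable.eqv _

/-- The variable for the `k`-th entry of the context. -/
noncomputable def ctxVar (k : ℕ) : ℕ := varEquiv (.inr (.inl k))

/-- Turn the innermost context variable into a variable reserved for quantification. -/
def shiftSum : ℕ ⊕ ℕ ⊕ ℕ → ℕ ⊕ ℕ ⊕ ℕ
  | .inl k => .inl k
  | .inr (.inl 0) => .inr (.inr 0)
  | .inr (.inl (k + 1)) => .inr (.inl k)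
  | .inr (.inr k) => .inr (.inr (k + 1))

/-- The renaming of variables induced by `shiftSum`. -/
noncomputable def shiftVar (n : ℕ) : ℕ := varEquiv (shiftSum (varEquiv.symm n))

/-- The reserved variable freed by `shiftVar`. -/
noncomputable def freshVar : ℕ := varEquiv (.inr (.inr 0))

theorem shiftSum_injective : Function.Injective shiftSum := by
  rintro (a | (_ | a) | a) (b | (_ | b) | b) h <;> simp_all [shiftSum]

theorem shiftVar_injective : Function.Injective shiftVar :=
  varEquiv.injective.comp (shiftSum_injective.comp varEquiv.symm.injective)

section Represent

variable {T : Model}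

/-- The valuation combining the enumeration of the constants, a context and values of the reserved
variables. -/
noncomputable def Model.val (T : Model) (x j : ℕ → T.S.M) (n : ℕ) : T.S.M :=
  match varEquiv.symm n with
  | .inl k => T.num k
  | .inr (.inl k) => x k
  | .inr (.inr k) => j k

theorem val_ctxVar (x j : ℕ → T.S.M) (k : ℕ) : T.val x j (ctxVar k) = x k := by
  simp [Model.val, ctxVar]

theorem val_shift (x j : ℕ → T.S.M) (m : T.S.M) :
    (fun i => upd (T.val x j) freshVar m (shiftVar i)) =
      T.val (push m x) (fun k => j (k + 1)) := by
  funext n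
  obtain ⟨s, rfl⟩ := varEquiv.surjective n
  rcases s with a | (_ | a) | a <;>
    simp [upd, Model.val, shiftVar, freshVar, shiftSum, push]

theorem upd_val_ctxVar (x j : ℕ → T.S.M) (m : T.S.M) :
    upd (T.val x j) (ctxVar 0) m = T.val (push m fun k => x (k + 1)) j := by
  funext n
  obtain ⟨s, rfl⟩ := varEquiv.surjective n
  rcases s with a | (_ | a) | a <;>
    simp [upd, Model.val, ctxVar, push]

/-- The formula `φ` represents the relation `P` on contexts. -/
def Rep (φ : Fml) (P : (ℕ → T.S.M) → Prop) : Prop :=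
  ∀ x j, P x ↔ Sat T.S T.X (T.val x j) T.sets φ

/-- Functions of the context given by terms. -/
def Tm (t : (ℕ → T.S.M) → T.S.M) : Prop :=
  ∃ τ, ∀ x j, t x = tval T.S (T.val x j) τ

/-- Relations on contexts defined by `Δ₀⁰` formulas. -/
def Bdd (P : (ℕ → T.S.M) → Prop) : Prop := ∃ φ, Delta0SO φ ∧ Rep φ P

/-- Relations on contexts defined by `Σ₁⁰` formulas. -/
def Sig (P : (ℕ → T.S.M) → Prop) : Prop :=
  ∃ Q : (ℕ → T.S.M) → Prop, Bdd Q ∧ ∀ x, P x ↔ ∃ m, Q (push m x)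

theorem Rep.shift {φ : Fml} {P : (ℕ → T.S.M) → Prop} (h : Rep φ P) (hφ : φ.NoSetQuant)
    (x j : ℕ → T.S.M) (m : T.S.M) :
    Sat T.S T.X (upd (T.val x j) freshVar m) T.sets (φ.rename shiftVar id) ↔ P (push m x) := by
  rw [sat_rename _ _ shiftVar_injective _ _ hφ, val_shift]
  exact (h _ _).symm

theorem Tm.var (k : ℕ) : Tm (fun x : ℕ → T.S.M => x k) :=
  ⟨.var (ctxVar k), fun x j => (val_ctxVar x j k).symm⟩

theorem Tm.const (a : T.S.M) : Tm (fun _ : ℕ → T.S.M => a) := by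
  obtain ⟨k, rfl⟩ := T.num_surjective a
  exact ⟨.var (varEquiv (.inl k)), fun x j => by simp [tval, Model.val]⟩

theorem Tm.add {s t : (ℕ → T.S.M) → T.S.M} (hs : Tm s) (ht : Tm t) : Tm (fun x => s x + t x) := by
  obtain ⟨σ, hσ⟩ := hs
  obtain ⟨τ, hτ⟩ := ht
  exact ⟨.add σ τ, fun x j => congrArg₂ T.S.add (hσ x j) (hτ x j)⟩

theorem Tm.mul {s t : (ℕ → T.S.M) → T.S.M} (hs : Tm s) (ht : Tm t) : Tm (fun x => s x * t x) := by
  obtain ⟨σ, hσ⟩ := hs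
  obtain ⟨τ, hτ⟩ := ht
  exact ⟨.mul σ τ, fun x j => congrArg₂ T.S.mul (hσ x j) (hτ x j)⟩

theorem Tm.weaken {t : (ℕ → T.S.M) → T.S.M} (ht : Tm t) : Tm (fun x => t (fun k => x (k + 1))) := by
  obtain ⟨τ, hτ⟩ := ht
  let r : ℕ ⊕ ℕ ⊕ ℕ → ℕ ⊕ ℕ ⊕ ℕ := Sum.map id (Sum.map (· + 1) id)
  refine ⟨τ.rename (fun n => varEquiv (r (varEquiv.symm n))), fun x j => ?_⟩
  beta_reduce
  rw [tval_rename, hτ _ j]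
  congr 1
  funext n
  obtain ⟨s, rfl⟩ := varEquiv.surjective n
  rcases s with a | a | a <;> simp [Model.val, r]

theorem Tm.tval {t : ℕ → (ℕ → T.S.M) → T.S.M} (ht : ∀ k, Tm (t k)) (τ : Term) :
    Tm (fun x => tval T.S (fun k => t k x) τ) := by
  induction τ with
  | var i => exact ht i
  | zero => exact .const 0
  | one => exact .const 1
  | add _ _ ih ih' => exact ih.add ih'
  | mul _ _ ih ih' => exact ih.mul ih'

theorem Bdd.congr {P Q : (ℕ → T.S.M) → Prop} (h : Bdd P) (hPQ : ∀ x, Q x ↔ P x) : Bdd Q := by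
  rwa [show Q = P from funext fun x => propext (hPQ x)]

theorem Bdd.eq {s t : (ℕ → T.S.M) → T.S.M} (hs : Tm s) (ht : Tm t) : Bdd (fun x => s x = t x) := by
  obtain ⟨σ, hσ⟩ := hs
  obtain ⟨τ, hτ⟩ := ht
  exact ⟨.eq σ τ, .eq _ _, fun x j => by beta_reduce; rw [hσ x j, hτ x j]; rfl⟩

theorem Bdd.lt {s t : (ℕ → T.S.M) → T.S.M} (hs : Tm s) (ht : Tm t) : Bdd (fun x => s x < t x) := by
  obtain ⟨σ, hσ⟩ := hs
  obtain ⟨τ, hτ⟩ := ht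
  exact ⟨.lt σ τ, .lt _ _, fun x j => by beta_reduce; rw [hσ x j, hτ x j]; rfl⟩

theorem Bdd.mem {t : (ℕ → T.S.M) → T.S.M} (ht : Tm t) {A : Set T.S.M} (hA : A ∈ T.X) :
    Bdd (fun x => t x ∈ A) := by
  obtain ⟨τ, hτ⟩ := ht
  obtain ⟨i, rfl⟩ := T.sets_surjective A hA
  exact ⟨.mem τ i, .mem _ _, fun x j => by beta_reduce; rw [hτ x j]; rfl⟩

theorem Bdd.not {P : (ℕ → T.S.M) → Prop} (h : Bdd P) : Bdd (fun x => ¬ P x) := by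
  obtain ⟨φ, hφ, h⟩ := h
  exact ⟨.not φ, .not hφ, fun x j => not_congr (h x j)⟩

theorem Bdd.and {P Q : (ℕ → T.S.M) → Prop} (h : Bdd P) (h' : Bdd Q) : Bdd (fun x => P x ∧ Q x) := by
  obtain ⟨φ, hφ, h⟩ := h
  obtain ⟨ψ, hψ, h'⟩ := h'
  exact ⟨.and φ ψ, .and hφ hψ, fun x j => and_congr (h x j) (h' x j)⟩

theorem Bdd.or {P Q : (ℕ → T.S.M) → Prop} (h : Bdd P) (h' : Bdd Q) : Bdd (fun x => P x ∨ Q x) :=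
  (h.not.and h'.not).not.congr fun x => by tauto

theorem Bdd.imp {P Q : (ℕ → T.S.M) → Prop} (h : Bdd P) (h' : Bdd Q) : Bdd (fun x => P x → Q x) :=
  (h.not.or h').congr fun x => by tauto

theorem Bdd.bex {t : (ℕ → T.S.M) → T.S.M} {Q : T.S.M → (ℕ → T.S.M) → Prop} (ht : Tm t)
    (h : Bdd (fun x => Q (x 0) (fun k => x (k + 1)))) : Bdd (fun x => ∃ m < t x, Q m x) := by
  obtain ⟨τ, hτ⟩ := ht
  obtain ⟨φ, hφ, h⟩ := h
  refine ⟨.bex freshVar τ (φ.rename shiftVar id), .bex _ _ (hφ.rename _ _), fun x j => ?_⟩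
  simp only [Sat, h.shift hφ.noSetQuant, ← hτ x j]
  rfl

theorem Bdd.ball {t : (ℕ → T.S.M) → T.S.M} {Q : T.S.M → (ℕ → T.S.M) → Prop} (ht : Tm t)
    (h : Bdd (fun x => Q (x 0) (fun k => x (k + 1)))) : Bdd (fun x => ∀ m < t x, Q m x) :=
  (Bdd.bex (Q := fun m x => ¬ Q m x) ht h.not).not.congr fun x => by simp

theorem push_upd {α : Type} (t : ℕ → (ℕ → α) → α) (y : ℕ) (m : α) (x : ℕ → α) :
    upd (fun k => t k x) y m =
      fun k => (fun k x => if k = y then x 0 else t k (fun i => x (i + 1))) k (push m x) := by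
  funext k
  simp [upd, push]

theorem Delta0SO.bdd_sat {φ : Fml} (hφ : Delta0SO φ) {w : ℕ → Set T.S.M} (hw : ∀ i, w i ∈ T.X)
    {t : ℕ → (ℕ → T.S.M) → T.S.M} (ht : ∀ k, Tm (t k)) :
    Bdd (fun x => Sat T.S T.X (fun k => t k x) w φ) := by
  have key : ∀ (t : ℕ → (ℕ → T.S.M) → T.S.M), (∀ k, Tm (t k)) → ∀ y k,
      Tm (fun x => if k = y then x 0 else t k (fun i => x (i + 1))) := by
    intro t ht y k
    split_ifs
    · exact .var 0
    · exact (ht k).weaken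
  induction hφ generalizing t with
  | eq s u => exact .eq (.tval ht s) (.tval ht u)
  | lt s u => exact .lt (.tval ht s) (.tval ht u)
  | mem s i => exact .mem (.tval ht s) (hw i)
  | not _ ih => exact (ih ht).not
  | and _ _ ih ih' => exact (ih ht).and (ih' ht)
  | or _ _ ih ih' => exact (ih ht).or (ih' ht)
  | imp _ _ ih ih' => exact (ih ht).imp (ih' ht)
  | ball y s _ ih =>
    simp only [Sat, push_upd]
    exact .ball (.tval ht s) (ih (key t ht y))
  | bex y s _ ih =>
    simp only [Sat, push_upd]
    exact .bex (.tval ht s) (ih (key t ht y))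

theorem Bdd.subst {P : (ℕ → T.S.M) → Prop} (h : Bdd P) {t : ℕ → (ℕ → T.S.M) → T.S.M}
    (ht : ∀ k, Tm (t k)) : Bdd (fun x => P (fun k => t k x)) := by
  obtain ⟨φ, hφ, h⟩ := h
  have key : ∀ n, Tm (fun x : ℕ → T.S.M => T.val (fun k => t k x) (fun _ => 0) n) := by
    intro n
    obtain ⟨s, rfl⟩ := varEquiv.surjective n
    rcases s with a | a | a
    · simpa [Model.val] using Tm.const (T.num a)
    · simpa [Model.val] using ht a
    · simpa [Model.val] using Tm.const (0 : T.S.M)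
  exact (hφ.bdd_sat T.sets_mem key).congr fun x => h _ _

theorem Sig.congr {P Q : (ℕ → T.S.M) → Prop} (h : Sig P) (hPQ : ∀ x, Q x ↔ P x) : Sig Q := by
  rwa [show Q = P from funext fun x => propext (hPQ x)]

/-- Rearrangement of a context by terms, keeping the innermost variable. -/
theorem Tm.push {t : ℕ → (ℕ → T.S.M) → T.S.M} (ht : ∀ k, Tm (t k)) {s : (ℕ → T.S.M) → T.S.M}
    (hs : Tm s) : ∀ k, Tm (fun x => push (s x) (fun k => t k x) k)
  | 0 => hs
  | k + 1 => ht k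

theorem Sig.subst {P : (ℕ → T.S.M) → Prop} (h : Sig P) {t : ℕ → (ℕ → T.S.M) → T.S.M}
    (ht : ∀ k, Tm (t k)) : Sig (fun x => P (fun k => t k x)) := by
  obtain ⟨Q, hQ, h⟩ := h
  exact ⟨_, hQ.subst (Tm.push (fun k => (ht k).weaken) (.var 0)), fun _ => h _⟩

theorem Bdd.sig {P : (ℕ → T.S.M) → Prop} (h : Bdd P) : Sig P :=
  ⟨_, h.subst fun k => .var (k + 1), fun _ => ⟨fun hx => ⟨0, hx⟩, fun ⟨_, hx⟩ => hx⟩⟩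

theorem Sig.ex {Q : T.S.M → (ℕ → T.S.M) → Prop}
    (h : Sig (fun x => Q (x 0) (fun k => x (k + 1)))) : Sig (fun x => ∃ m, Q m x) := by
  obtain ⟨R, hR, h⟩ := h
  refine ⟨fun x => ∃ m < x 0, ∃ s < x 0,
      R (PaperArith.push s (PaperArith.push m fun k => x (k + 1))),
    .bex (.var 0) (.bex (.var 1) (hR.subst
      (Tm.push (Tm.push (fun k => .var (k + 3)) (.var 1)) (.var 0)))), fun x => ?_⟩
  constructor
  · rintro ⟨m, hm⟩
    obtain ⟨s, hs⟩ := (h (PaperArith.push m x)).1 hm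
    exact ⟨max m s + 1, m, Model.lt_add_one_iff.2 (le_max_left _ _), s,
      Model.lt_add_one_iff.2 (le_max_right _ _), hs⟩
  · rintro ⟨_, m, _, s, _, hs⟩
    exact ⟨m, (h (PaperArith.push m x)).2 ⟨s, hs⟩⟩

theorem Sig.and {P Q : (ℕ → T.S.M) → Prop} (hP : Sig P) (hQ : Sig Q) :
    Sig (fun x => P x ∧ Q x) := by
  obtain ⟨P', hP', hP⟩ := hP
  obtain ⟨Q', hQ', hQ⟩ := hQ
  refine (Sig.ex (Q := fun m x => ∃ s, P' (PaperArith.push m x) ∧ Q' (PaperArith.push s x))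
    (Sig.ex (Bdd.sig (.and (hP'.subst (Tm.push (fun k => .var (k + 2)) (.var 1)))
      (hQ'.subst (Tm.push (fun k => .var (k + 2)) (.var 0))))))).congr fun x => ?_
  rw [hP, hQ]
  exact ⟨fun ⟨⟨m, hm⟩, s, hs⟩ => ⟨m, s, hm, hs⟩, fun ⟨m, s, hm, hs⟩ => ⟨⟨m, hm⟩, s, hs⟩⟩

theorem Sig.or {P Q : (ℕ → T.S.M) → Prop} (hP : Sig P) (hQ : Sig Q) : Sig (fun x => P x ∨ Q x) := by
  obtain ⟨P', hP', hP⟩ := hP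
  obtain ⟨Q', hQ', hQ⟩ := hQ
  refine ⟨_, hP'.or hQ', fun x => ?_⟩
  beta_reduce
  rw [hP, hQ, exists_or]

theorem Sig.bex {t : (ℕ → T.S.M) → T.S.M} {Q : T.S.M → (ℕ → T.S.M) → Prop} (ht : Tm t)
    (h : Sig (fun x => Q (x 0) (fun k => x (k + 1)))) : Sig (fun x => ∃ m < t x, Q m x) :=
  Sig.ex ((Bdd.lt (.var 0) ht.weaken).sig.and h)

/-! ### Induction, comprehension and collection -/

theorem Sig.rep {P : (ℕ → T.S.M) → Prop} (h : Sig P) : ∃ φ, SigmaSO 1 φ ∧ Rep φ P := by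
  obtain ⟨Q, ⟨φ, hφ, h⟩, hPQ⟩ := h
  refine ⟨.ex freshVar (φ.rename shiftVar id), .ex _ (.delta0 (hφ.rename _ _)), fun x j => ?_⟩
  simp only [Sat, h.shift hφ.noSetQuant, hPQ]

theorem Sig.rep_not {P : (ℕ → T.S.M) → Prop} (h : Sig P) :
    ∃ φ, PiSO 1 φ ∧ φ.NoSetQuant ∧ Rep φ (fun x => ¬ P x) := by
  obtain ⟨Q, ⟨φ, hφ, h⟩, hPQ⟩ := h
  refine ⟨.all freshVar (.not (φ.rename shiftVar id)), .all _ (.delta0 (.not (hφ.rename _ _))),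
    (hφ.rename _ _).noSetQuant, fun x j => ?_⟩
  simp only [Sat, h.shift hφ.noSetQuant, hPQ, not_exists]

theorem Sig.induction {P : T.S.M → Prop} (h : Sig (fun x => P (x 0))) (h0 : P 0)
    (hs : ∀ m, P m → P (m + 1)) (m : T.S.M) : P m := by
  obtain ⟨φ, hφ, h⟩ := h.rep
  have key : ∀ m,
      Sat T.S T.X (upd (T.val (fun _ => 0) (fun _ => 0)) (ctxVar 0) m) T.sets φ ↔ P m := by
    intro m
    rw [upd_val_ctxVar]
    exact (h _ _).symm
  have := T.ind₁ φ hφ (T.val (fun _ => 0) (fun _ => 0)) T.sets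
    T.sets_mem (ctxVar 0)
  simp only [key] at this
  exact this h0 hs m

theorem Sig.induction₂ {P : T.S.M → T.S.M → Prop} (h : Sig (fun x => P (x 0) (x 1)))
    (h0 : ∃ b, ¬ P b 0) (hs : ∀ m, (∃ b, ¬ P b m) → ∃ b, ¬ P b (m + 1)) (m : T.S.M) :
    ∃ b, ¬ P b m := by
  obtain ⟨φ, hφ, hn, h⟩ := h.rep_not
  have key : ∀ m, Sat T.S T.X (upd (T.val (fun _ => 0) (fun _ => 0)) (ctxVar 0) m) T.sets
      (.ex freshVar (φ.rename shiftVar id)) ↔ ∃ b, ¬ P b m := by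
    intro m
    rw [upd_val_ctxVar]
    simp only [Sat, h.shift hn]
    rfl
  have := T.ind₂ _ (.ex freshVar (.ofPi (hφ.rename shiftVar id)))
    (T.val (fun _ => 0) (fun _ => 0)) T.sets
    T.sets_mem (ctxVar 0)
  simp only [key] at this
  exact this h0 hs m

theorem Sig.setOf_mem {P : T.S.M → Prop} (h : Sig (fun x => P (x 0)))
    (h' : Sig (fun x => ¬ P (x 0))) : {m | P m} ∈ T.X := by
  obtain ⟨φ, hφ, h⟩ := h.rep
  obtain ⟨ψ, hψ, hn, h'⟩ := h'.rep_not
  have key : ∀ m,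
      Sat T.S T.X (upd (T.val (fun _ => 0) (fun _ => 0)) (ctxVar 0) m) T.sets φ ↔ P m := by
    intro m
    rw [upd_val_ctxVar]
    exact (h _ _).symm
  have key' : ∀ m,
      Sat T.S T.X (upd (T.val (fun _ => 0) (fun _ => 0)) (ctxVar 0) m) T.sets ψ ↔ P m := by
    intro m
    rw [upd_val_ctxVar]
    exact ((h' (push m fun _ => 0) _).symm.trans not_not)
  obtain ⟨A, hA, hAP⟩ := T.ca φ ψ hφ hψ (T.val (fun _ => 0) (fun _ => 0)) T.sets
    T.sets_mem (ctxVar 0)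
    (fun m => (key m).trans (key' m).symm)
  convert hA
  ext m
  rw [hAP, key]
  rfl

theorem Sig.ball {t : (ℕ → T.S.M) → T.S.M} {Q : T.S.M → (ℕ → T.S.M) → Prop} (ht : Tm t)
    (h : Sig (fun x => Q (x 0) (fun k => x (k + 1)))) : Sig (fun x => ∀ m < t x, Q m x) := by
  obtain ⟨R, hR, h⟩ := h
  refine ⟨fun x => ∀ m < t (fun k => x (k + 1)), ∃ s < x 0,
      R (PaperArith.push s (PaperArith.push m fun k => x (k + 1))),
    .ball ht.weaken (.bex (.var 1) (hR.subst
      (Tm.push (Tm.push (fun k => .var (k + 3)) (.var 1)) (.var 0)))), fun x => ?_⟩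
  constructor
  · intro hx
    have : ∀ n, ∃ b, ∀ m < n, m < t x → ∃ s < b, R (PaperArith.push s (PaperArith.push m x)) := by
      refine Sig.induction (Sig.ex (Bdd.sig (.ball (.var 1) (.imp (.lt (.var 0) (.const _))
        (.bex (.var 1) (hR.subst (Tm.push (Tm.push (fun k => .const _) (.var 1)) (.var 0)))))))) ?_ ?_
      · exact ⟨0, fun m hm => absurd hm not_lt_zero⟩
      · rintro n ⟨b, hb⟩
        by_cases hn : n < t x
        · obtain ⟨s, hs⟩ := (h (PaperArith.push n x)).1 (hx n hn)
          refine ⟨max b (s + 1), fun m hm hmt => ?_⟩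
          rcases (Model.lt_add_one_iff.1 hm).lt_or_eq with hm | rfl
          · obtain ⟨s', hs', hR'⟩ := hb m hm hmt
            exact ⟨s', lt_max_of_lt_left hs', hR'⟩
          · exact ⟨s, lt_max_of_lt_right (Model.lt_add_one_iff.2 le_rfl), hs⟩
        · refine ⟨b, fun m hm hmt => hb m ?_ hmt⟩
          exact hmt.trans_le (not_lt.1 hn)
    obtain ⟨b, hb⟩ := this (t x)
    exact ⟨b, fun m hm => hb m hm hm⟩
  · rintro ⟨b, hb⟩ m hm
    obtain ⟨s, _, hs⟩ := hb m hm
    exact (h (PaperArith.push m x)).2 ⟨s, hs⟩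

end Represent

/-! ## Computable relations and functions -/

section Computable

variable {T : Model}

/-- Relations on contexts that are `Δ₁⁰`. -/
def Dec (P : (ℕ → T.S.M) → Prop) : Prop := Sig P ∧ Sig (fun x => ¬ P x)

/-- Functions of the context with a `Σ₁⁰` graph. -/
def Fn (f : (ℕ → T.S.M) → T.S.M) : Prop := Sig (fun x => x 0 = f (fun k => x (k + 1)))

theorem Bdd.dec {P : (ℕ → T.S.M) → Prop} (h : Bdd P) : Dec P := ⟨h.sig, h.not.sig⟩

theorem Dec.congr {P Q : (ℕ → T.S.M) → Prop} (h : Dec P) (hPQ : ∀ x, Q x ↔ P x) : Dec Q := by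
  rwa [show Q = P from funext fun x => propext (hPQ x)]

theorem Dec.not {P : (ℕ → T.S.M) → Prop} (h : Dec P) : Dec (fun x => ¬ P x) :=
  ⟨h.2, h.1.congr fun _ => not_not⟩

theorem Dec.and {P Q : (ℕ → T.S.M) → Prop} (h : Dec P) (h' : Dec Q) : Dec (fun x => P x ∧ Q x) :=
  ⟨h.1.and h'.1, (h.2.or h'.2).congr fun _ => not_and_or⟩

theorem Dec.or {P Q : (ℕ → T.S.M) → Prop} (h : Dec P) (h' : Dec Q) : Dec (fun x => P x ∨ Q x) :=
  ⟨h.1.or h'.1, (h.2.and h'.2).congr fun _ => not_or⟩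

theorem Dec.imp {P Q : (ℕ → T.S.M) → Prop} (h : Dec P) (h' : Dec Q) : Dec (fun x => P x → Q x) :=
  (h.not.or h').congr fun _ => imp_iff_not_or

theorem Dec.iff {P Q : (ℕ → T.S.M) → Prop} (h : Dec P) (h' : Dec Q) : Dec (fun x => P x ↔ Q x) :=
  ((h.imp h').and (h'.imp h)).congr fun _ => iff_iff_implies_and_implies

theorem Dec.subst {P : (ℕ → T.S.M) → Prop} (h : Dec P) {t : ℕ → (ℕ → T.S.M) → T.S.M}
    (ht : ∀ k, Tm (t k)) : Dec (fun x => P (fun k => t k x)) :=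
  ⟨h.1.subst ht, h.2.subst ht⟩

theorem Fn.weaken {f : (ℕ → T.S.M) → T.S.M} (h : Fn f) : Fn (fun x => f (fun k => x (k + 1))) :=
  Sig.subst (t := fun k x => push (x 0) (fun k => x (k + 2)) k) h
    (Tm.push (fun k => .var (k + 2)) (.var 0))

theorem Tm.fn {t : (ℕ → T.S.M) → T.S.M} (h : Tm t) : Fn t := (Bdd.eq (.var 0) h.weaken).sig

theorem Fn.var (k : ℕ) : Fn (fun x : ℕ → T.S.M => x k) := (Tm.var k).fn

theorem Fn.const (a : T.S.M) : Fn (fun _ : ℕ → T.S.M => a) := (Tm.const a).fn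

theorem Sig.app {Q : T.S.M → (ℕ → T.S.M) → Prop} {f : (ℕ → T.S.M) → T.S.M} (hf : Fn f)
    (h : Sig (fun x => Q (x 0) (fun k => x (k + 1)))) : Sig (fun x => Q (f x) x) :=
  (Sig.ex (Q := fun m x => m = f x ∧ Q m x) (Sig.and hf h)).congr fun _ => by simp

theorem Dec.app {Q : T.S.M → (ℕ → T.S.M) → Prop} {f : (ℕ → T.S.M) → T.S.M} (hf : Fn f)
    (h : Dec (fun x => Q (x 0) (fun k => x (k + 1)))) : Dec (fun x => Q (f x) x) :=
  ⟨h.1.app hf, Sig.app (Q := fun m x => ¬ Q m x) hf h.2⟩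

theorem Sig.app₂ {R : T.S.M → T.S.M → Prop} {f g : (ℕ → T.S.M) → T.S.M}
    (h : Sig (fun x => R (x 0) (x 1))) (hf : Fn f) (hg : Fn g) : Sig (fun x => R (f x) (g x)) := by
  refine Sig.app (Q := fun m x => R m (g x)) hf
    (Sig.app (Q := fun m x => R (x 0) m) hg.weaken ?_)
  exact h.subst (t := fun k x => push (x 1) (fun _ => x 0) k) (Tm.push (fun k => .var 0) (.var 1))

theorem Dec.app₂ {R : T.S.M → T.S.M → Prop} {f g : (ℕ → T.S.M) → T.S.M}
    (h : Dec (fun x => R (x 0) (x 1))) (hf : Fn f) (hg : Fn g) : Dec (fun x => R (f x) (g x)) :=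
  ⟨h.1.app₂ hf hg, Sig.app₂ (R := fun a b => ¬ R a b) h.2 hf hg⟩

theorem Dec.eq {f g : (ℕ → T.S.M) → T.S.M} (hf : Fn f) (hg : Fn g) : Dec (fun x => f x = g x) :=
  Dec.app₂ (Bdd.eq (.var 0) (.var 1)).dec hf hg

theorem Dec.lt {f g : (ℕ → T.S.M) → T.S.M} (hf : Fn f) (hg : Fn g) : Dec (fun x => f x < g x) :=
  Dec.app₂ (Bdd.lt (.var 0) (.var 1)).dec hf hg

theorem Dec.mem {f : (ℕ → T.S.M) → T.S.M} (hf : Fn f) {A : Set T.S.M} (hA : A ∈ T.X) :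
    Dec (fun x => f x ∈ A) :=
  Dec.app (Q := fun m _ => m ∈ A) hf (Bdd.mem (.var 0) hA).dec

theorem Fn.app {F : T.S.M → T.S.M} {f : (ℕ → T.S.M) → T.S.M} (hF : Fn (fun x => F (x 0)))
    (hf : Fn f) : Fn (fun x => F (f x)) :=
  Sig.app₂ (R := fun a b => a = F b) hF (.var 0) hf.weaken

theorem Fn.add {f g : (ℕ → T.S.M) → T.S.M} (hf : Fn f) (hg : Fn g) : Fn (fun x => f x + g x) := by
  refine Sig.app (Q := fun m x => x 0 = m + g (fun k => x (k + 1))) hf.weaken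
    (Sig.app (Q := fun m x => x 1 = x 0 + m) hg.weaken.weaken ?_)
  exact (Bdd.eq (.var 2) (.add (.var 1) (.var 0))).sig

theorem Fn.mul {f g : (ℕ → T.S.M) → T.S.M} (hf : Fn f) (hg : Fn g) : Fn (fun x => f x * g x) := by
  refine Sig.app (Q := fun m x => x 0 = m * g (fun k => x (k + 1))) hf.weaken
    (Sig.app (Q := fun m x => x 1 = x 0 * m) hg.weaken.weaken ?_)
  exact (Bdd.eq (.var 2) (.mul (.var 1) (.var 0))).sig

theorem Fn.tval {f : ℕ → (ℕ → T.S.M) → T.S.M} (hf : ∀ k, Fn (f k)) (τ : Term) :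
    Fn (fun x => tval T.S (fun k => f k x) τ) := by
  induction τ with
  | var i => exact hf i
  | zero => exact .const 0
  | one => exact .const 1
  | add _ _ ih ih' => exact ih.add ih'
  | mul _ _ ih ih' => exact ih.mul ih'

theorem Dec.bex {f : (ℕ → T.S.M) → T.S.M} {Q : T.S.M → (ℕ → T.S.M) → Prop} (hf : Fn f)
    (h : Dec (fun x => Q (x 0) (fun k => x (k + 1)))) : Dec (fun x => ∃ m < f x, Q m x) := by
  have h' : Dec (fun x => Q (x 0) (fun k => x (k + 2))) :=
    h.subst (t := fun k x => push (x 0) (fun k => x (k + 2)) k)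
      (Tm.push (fun k => .var (k + 2)) (.var 0))
  refine Dec.app (Q := fun b x => ∃ m < b, Q m x) hf ⟨.bex (.var 0) h'.1, ?_⟩
  exact (Sig.ball (Q := fun m x => ¬ Q m fun k => x (k + 1)) (.var 0) h'.2).congr fun x => by simp

theorem Dec.ball {f : (ℕ → T.S.M) → T.S.M} {Q : T.S.M → (ℕ → T.S.M) → Prop} (hf : Fn f)
    (h : Dec (fun x => Q (x 0) (fun k => x (k + 1)))) : Dec (fun x => ∀ m < f x, Q m x) :=
  (Dec.bex (Q := fun m x => ¬ Q m x) hf h.not).not.congr fun x => by simp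

theorem Fn.update {f : ℕ → (ℕ → T.S.M) → T.S.M} (hf : ∀ k, Fn (f k)) (y k : ℕ) :
    Fn (fun x => if k = y then x 0 else f k (fun i => x (i + 1))) := by
  split_ifs
  · exact .var 0
  · exact (hf k).weaken

theorem Delta0SO.dec_sat {φ : Fml} (hφ : Delta0SO φ) {w : ℕ → Set T.S.M} (hw : ∀ i, w i ∈ T.X)
    {f : ℕ → (ℕ → T.S.M) → T.S.M} (hf : ∀ k, Fn (f k)) :
    Dec (fun x => Sat T.S T.X (fun k => f k x) w φ) := by
  induction hφ generalizing f with
  | eq s u => exact .eq (.tval hf s) (.tval hf u)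
  | lt s u => exact .lt (.tval hf s) (.tval hf u)
  | mem s i => exact .mem (.tval hf s) (hw i)
  | not _ ih => exact (ih hf).not
  | and _ _ ih ih' => exact (ih hf).and (ih' hf)
  | or _ _ ih ih' => exact (ih hf).or (ih' hf)
  | imp _ _ ih ih' => exact (ih hf).imp (ih' hf)
  | ball y s _ ih =>
    simp only [Sat, push_upd]
    exact .ball (.tval hf s) (ih (Fn.update hf y))
  | bex y s _ ih =>
    simp only [Sat, push_upd]
    exact .bex (.tval hf s) (ih (Fn.update hf y))

theorem SigmaSO.sig_sat {φ : Fml} (hφ : SigmaSO 1 φ) {w : ℕ → Set T.S.M} (hw : ∀ i, w i ∈ T.X)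
    {f : ℕ → (ℕ → T.S.M) → T.S.M} (hf : ∀ k, Fn (f k)) :
    Sig (fun x => Sat T.S T.X (fun k => f k x) w φ) := by
  induction φ generalizing f with
  | ex y φ ih =>
    cases hφ with
    | delta0 h => exact (h.dec_sat hw hf).1
    | ofPi h => cases h with | delta0 h => exact (h.dec_sat hw hf).1
    | ex _ h =>
      simp only [Sat, push_upd]
      exact .ex (ih h (Fn.update hf y))
  | _ =>
    cases hφ with
    | delta0 h => exact (h.dec_sat hw hf).1
    | ofPi h => cases h with | delta0 h => exact (h.dec_sat hw hf).1

theorem PiSO.sig_not_sat {φ : Fml} (hφ : PiSO 1 φ) {w : ℕ → Set T.S.M} (hw : ∀ i, w i ∈ T.X)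
    {f : ℕ → (ℕ → T.S.M) → T.S.M} (hf : ∀ k, Fn (f k)) :
    Sig (fun x => ¬ Sat T.S T.X (fun k => f k x) w φ) := by
  induction φ generalizing f with
  | all y φ ih =>
    cases hφ with
    | delta0 h => exact (h.dec_sat hw hf).2
    | ofSigma h => cases h with | delta0 h => exact (h.dec_sat hw hf).2
    | all _ h =>
      simp only [Sat, push_upd, not_forall]
      exact .ex (Q := fun m x => ¬ Sat T.S T.X (fun k => (fun k x => if k = y then x 0
        else f k (fun i => x (i + 1))) k (push m x)) w φ) (ih h (Fn.update hf y))
  | _ =>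
    cases hφ with
    | delta0 h => exact (h.dec_sat hw hf).2
    | ofSigma h => cases h with | delta0 h => exact (h.dec_sat hw hf).2

/-! ### Selection and thinning -/

theorem Dec.exists_least {P : T.S.M → Prop} (h : Dec (fun x => P (x 0))) {a : T.S.M} (ha : P a) :
    ∃ m, P m ∧ ∀ n < m, ¬ P n := by
  by_contra hcon
  push Not at hcon
  have : ∀ m, ∀ n < m, ¬ P n := by
    refine Sig.induction (Sig.ball (.var 0) h.2) (fun n hn => absurd hn not_lt_zero)
      fun m hm n hn hP => ?_
    rcases (Model.lt_add_one_iff.1 hn).lt_or_eq with hn | rfl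
    · exact hm n hn hP
    · obtain ⟨k, hk, hPk⟩ := hcon n hP
      exact hm k hk hPk
  exact this (a + 1) a (Model.lt_add_one_iff.2 le_rfl) ha

theorem Dec.select {R : T.S.M → T.S.M → Prop} (h : Dec (fun x => R (x 0) (x 1)))
    (hR : ∀ a, ∃ b, R a b) : ∃ f : T.S.M → T.S.M, Fn (fun x => f (x 0)) ∧ ∀ a, R a (f a) := by
  have : ∀ a, ∃ b, R a b ∧ ∀ c < b, ¬ R a c := fun a => by
    obtain ⟨b, hb⟩ := hR a
    exact Dec.exists_least (P := R a) (h.app₂ (.const a) (.var 0)) hb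
  choose f hf hmin using this
  refine ⟨f, ?_, hf⟩
  refine Sig.congr (P := fun x => R (x 1) (x 0) ∧ ∀ c < x 0, ¬ R (x 1) c)
    (.and (h.app₂ (.var 1) (.var 0)).1 (.ball (Q := fun c x => ¬ R (x 1) c) (.var 0)
      (h.app₂ (.var 2) (.var 0)).2)) fun x => ?_
  constructor
  · intro hx
    rw [hx]
    exact ⟨hf _, hmin _⟩
  · rintro ⟨h1, h2⟩
    rcases lt_trichotomy (x 0) (f (x 1)) with h3 | h3 | h3
    · exact absurd h1 (hmin _ _ h3)
    · exact h3
    · exact absurd (hf _) (h2 _ h3)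

theorem Sig.select {R : T.S.M → T.S.M → Prop} (h : Sig (fun x => R (x 0) (x 1)))
    (hR : ∀ a, ∃ b, R a b) : ∃ f : T.S.M → T.S.M, Fn (fun x => f (x 0)) ∧ ∀ a, R a (f a) := by
  obtain ⟨Q, hQ, h⟩ := h
  let Q' : T.S.M → T.S.M → T.S.M → Prop := fun s a b => Q (push s (push a fun _ => b))
  have hQ' : ∀ {f g k : (ℕ → T.S.M) → T.S.M}, Tm f → Tm g → Tm k →
      Dec (fun x => Q' (f x) (g x) (k x)) := fun hf hg hk =>
    (hQ.subst (Tm.push (Tm.push (fun _ => hk) hg) hf)).dec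
  have hRQ : ∀ a b, R a b ↔ ∃ s, Q' s a b :=
    fun a b => h (push a fun _ => b)
  obtain ⟨t, ht, htQ⟩ := Dec.select (R := fun a t => ∃ b < t, ∃ s < t, Q' s a b)
    (.bex (.var 1) (.bex (.var 2) (hQ' (.var 0) (.var 2) (.var 1)))) fun a => by
      obtain ⟨b, hb⟩ := hR a
      obtain ⟨s, hs⟩ := (hRQ a b).1 hb
      exact ⟨max b s + 1, b, Model.lt_add_one_iff.2 (le_max_left _ _), s,
        Model.lt_add_one_iff.2 (le_max_right _ _), hs⟩
  obtain ⟨f, hf, hfQ⟩ := Dec.select (R := fun a b => ∃ s < t a, Q' s a b)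
    (.bex (ht.app (.var 0)) (hQ' (.var 0) (.var 1) (.var 2))) fun a => by
      obtain ⟨b, _, hb⟩ := htQ a
      exact ⟨b, hb⟩
  refine ⟨f, hf, fun a => ?_⟩
  obtain ⟨s, _, hs⟩ := hfQ a
  exact (hRQ _ _).2 ⟨s, hs⟩

theorem Sig.exists_cofinal_subset {P : T.S.M → Prop} (h : Sig (fun x => P (x 0)))
    (hP : ∀ b, ∃ i, b < i ∧ P i) : ∃ B ∈ T.X, Cofinal T.S B ∧ ∀ i ∈ B, P i := by
  obtain ⟨f, hf, hfP⟩ := Sig.select (R := fun b i => b < i ∧ P i)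
    ((Bdd.lt (.var 0) (.var 1)).sig.and (h.subst fun _ => .var 1)) hP
  have hd : Dec (fun x => ∃ b < x 0, f b = x 0) :=
    .bex (.var 0) (.eq (hf.app (.var 0)) (.var 1))
  refine ⟨_, Sig.setOf_mem (P := fun i => ∃ b < i, f b = i) hd.1 hd.2, ?_, ?_⟩
  · intro b
    exact ⟨f b, ⟨b, (hfP b).1, rfl⟩, (hfP b).1⟩
  · rintro _ ⟨b, _, rfl⟩
    exact (hfP b).2

theorem Sig.exists_least_cofinal {P : T.S.M → T.S.M → Prop} (h : Sig (fun x => P (x 0) (x 1)))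
    {N : T.S.M} (hN : ∀ b, ∃ i, b < i ∧ ∃ n < N, P n i) :
    ∃ n, (∀ b, ∃ i, b < i ∧ P n i) ∧ ∃ b, ∀ i, b < i → ∀ k < n, ¬ P k i := by
  have hs : Sig (fun x => ∃ i, x 0 < i ∧ ∃ k < x 1, P k i) :=
    .ex (.and (Bdd.lt (.var 1) (.var 0)).sig (.bex (.var 2) (h.app₂ (.var 0) (.var 1))))
  by_contra hcon
  push Not at hcon
  obtain ⟨b, hb⟩ := Sig.induction₂ (P := fun b n => ∃ i, b < i ∧ ∃ k < n, P k i) hs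
    ⟨0, by rintro ⟨i, _, k, hk, _⟩; exact not_lt_zero hk⟩ (fun n ⟨b, hb⟩ => by
      by_cases hn : ∀ b, ∃ i, b < i ∧ P n i
      · obtain ⟨i, hi, k, hk, hP⟩ := hcon n hn b
        exact absurd ⟨i, hi, k, hk, hP⟩ hb
      · push Not at hn
        obtain ⟨c, hc⟩ := hn
        refine ⟨max b c, ?_⟩
        rintro ⟨i, hi, k, hk, hP⟩
        rcases (Model.lt_add_one_iff.1 hk).lt_or_eq with hk | rfl
        · exact hb ⟨i, (le_max_left _ _).trans_lt hi, k, hk, hP⟩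
        · exact hc i ((le_max_right _ _).trans_lt hi) hP) N
  exact hb (hN b)

end Computable

/-! ## Binary digits -/

section Digits

variable {T : Model}

theorem exists_quotient_remainder {q : T.S.M} (hq : 0 < q) (c : T.S.M) :
    ∃ u v, v < q ∧ c = u * q + v := by
  refine Sig.induction (P := fun c => ∃ u v, v < q ∧ c = u * q + v)
    (.ex (.ex (Bdd.sig (.and (.lt (.var 0) (.const q))
      (.eq (.var 2) (.add (.mul (.var 1) (.const q)) (.var 0))))))) ⟨0, 0, hq, by simp⟩ ?_ c
  rintro c ⟨u, v, hv, rfl⟩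
  rcases (Model.add_one_le_iff.2 hv).lt_or_eq with h | h
  · exact ⟨u, v + 1, h, by ring⟩
  · refine ⟨u + 1, 0, hq, ?_⟩
    rw [add_assoc, h]
    ring

theorem quotient_lt_of_lt {q u u' v v' : T.S.M} (hv : v < q) (h : u' * q + v' ≤ u * q + v) :
    u' ≤ u := by
  by_contra hlt
  rw [not_le, ← Model.add_one_le_iff] at hlt
  have h1 : u * q + v < (u + 1) * q := by
    rw [add_mul, one_mul]
    gcongr
  have h2 : (u + 1) * q ≤ u' * q + v' := (mul_le_mul_left hlt q).trans le_self_add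
  exact (h1.trans_le h2).not_ge h

theorem quotient_remainder_unique {q u u' v v' : T.S.M} (hv : v < q) (hv' : v' < q)
    (h : u * q + v = u' * q + v') : u = u' ∧ v = v' := by
  have hu : u = u' := le_antisymm (quotient_lt_of_lt hv' h.le) (quotient_lt_of_lt hv h.ge)
  subst hu
  exact ⟨rfl, add_left_cancel h⟩

/-- The `z`-th binary digit of `c` is `1`, where `p` is the function `z ↦ 2 ^ z`. -/
def Bit (p : T.S.M → T.S.M) (z c : T.S.M) : Prop :=
  ∃ u v, v < p z ∧ c = u * (p z + p z) + p z + v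

theorem bit_iff {p : T.S.M → T.S.M} {z c u r : T.S.M} (hr : r < p z + p z)
    (hc : c = u * (p z + p z) + r) : Bit p z c ↔ p z ≤ r := by
  constructor
  · rintro ⟨u', v, hv, rfl⟩
    have := (quotient_remainder_unique (u := u') (v := p z + v) (by gcongr) hr
      (by rw [← hc]; ring)).2
    rw [← this]
    exact le_self_add
  · intro h
    obtain ⟨v, rfl⟩ := exists_add_of_le h
    exact ⟨u, v, lt_of_add_lt_add_left hr, by rw [hc]; ring⟩

/-- The function `p` is the computable function `z ↦ 2 ^ z`. -/
structure IsPowTwo (p : T.S.M → T.S.M) : Prop where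
  fn : Fn (fun x => p (x 0))
  zero : p 0 = 1
  succ : ∀ z, p (z + 1) = p z + p z

theorem IsExpDef.exists_isPowTwo {E : Fml} (hE : IsExpDef T.S E) :
    ∃ p : T.S.M → T.S.M, IsPowTwo p ∧ ∀ z, ExpAt T.S E (1 + 1) z (p z) := by
  choose p hp using hE.total (1 + 1 : T.S.M)
  have key : ∀ z q, ExpAt T.S E (1 + 1) z q ↔ q = p z := fun z q =>
    ⟨fun h => hE.unique _ _ _ _ h (hp z), fun h => h ▸ hp z⟩
  refine ⟨p, ⟨?_, hE.unique _ _ _ _ (hp 0) (hE.base _), fun z => ?_⟩, hp⟩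
  · have : Bdd (fun x : ℕ → T.S.M => Sat T.S T.X
        (fun k => (fun (k : ℕ) (x : ℕ → T.S.M) => if k = 0 then 1 + 1 else if k = 1 then x 1
          else x 0) k x) T.sets E) := by
      refine hE.delta0.delta0SO.bdd_sat T.sets_mem fun k => ?_
      split_ifs
      · exact .const _
      · exact .var 1
      · exact .var 0
    refine this.sig.congr fun x => ?_
    rw [← key]
    exact hE.delta0.sat0_iff _ _ _
  · have := hE.unique _ _ _ _ (hp (z + 1)) (hE.step _ _ _ (hp z))
    rw [this]
    change p z * (1 + 1) = _
    ring

namespace IsPowTwo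

variable {p : T.S.M → T.S.M}

theorem pos (hp : IsPowTwo p) (z : T.S.M) : 0 < p z := by
  refine Sig.induction (P := fun z => 0 < p z) (Dec.lt (.const 0) hp.fn).1 ?_ ?_ z
  · rw [hp.zero]
    exact zero_lt_one
  · intro z hz
    rw [hp.succ]
    exact add_pos hz hz

theorem add (hp : IsPowTwo p) (z k : T.S.M) : p (z + k) = p z * p k := by
  refine Sig.induction (P := fun k => p (z + k) = p z * p k)
    (Dec.eq (hp.fn.app (.add (.const z) (.var 0))) (.mul (.const _) hp.fn)).1 ?_ ?_ k
  · rw [hp.zero, add_zero, mul_one]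
  · intro k hk
    rw [← add_assoc, hp.succ, hp.succ, hk, mul_add]

theorem exists_eq_mul_of_lt (hp : IsPowTwo p) {z z' : T.S.M} (h : z < z') :
    ∃ q, p z' = q * (p z + p z) := by
  obtain ⟨k, rfl⟩ := exists_add_of_le (Model.add_one_le_iff.2 h)
  exact ⟨p k, by rw [hp.add, hp.succ, mul_comm]⟩

theorem add_pos (hp : IsPowTwo p) (z : T.S.M) : 0 < p z + p z :=
  _root_.add_pos (hp.pos z) (hp.pos z)

theorem dec_bit (hp : IsPowTwo p) : Dec (fun x => Bit p (x 0) (x 1)) := by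
  constructor
  · have hp2 : Fn (fun x => p (x 2)) := hp.fn.app (.var 2)
    exact .ex (.ex (Dec.and (.lt (.var 0) hp2)
      (.eq (.var 3) (.add (.add (.mul (.var 1) (.add hp2 hp2)) hp2) (.var 0)))).1)
  · have hp2 : Fn (fun x => p (x 2)) := hp.fn.app (.var 2)
    refine Sig.congr (P := fun x => ∃ u v, v < p (x 0) ∧ x 1 = u * (p (x 0) + p (x 0)) + v)
      (.ex (.ex (Dec.and (.lt (.var 0) hp2)
      (.eq (.var 3) (.add (.mul (.var 1) (.add hp2 hp2)) (.var 0)))).1)) fun x => ?_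
    constructor
    · intro h
      obtain ⟨u, r, hr, hc⟩ := exists_quotient_remainder (hp.add_pos (x 0)) (x 1)
      beta_reduce at h
      rw [bit_iff hr hc, not_le] at h
      exact ⟨u, r, h, hc⟩
    · rintro ⟨u, r, hr, hc⟩
      beta_reduce
      rw [bit_iff (hr.trans_le le_self_add) hc, not_le]
      exact hr

theorem bit_add_iff (hp : IsPowTwo p) {z z' c u v : T.S.M} (hz : z ≠ z') (hv : v < p z)
    (hc : c = u * (p z + p z) + v) : Bit p z' (c + p z) ↔ Bit p z' c := by
  obtain ⟨U, r, hr, hU⟩ := exists_quotient_remainder (hp.add_pos z') c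
  rcases hz.lt_or_gt with h | h
  · obtain ⟨q, hq⟩ := hp.exists_eq_mul_of_lt h
    obtain ⟨k, s, hs, rfl⟩ := exists_quotient_remainder (hp.add_pos z) r
    have hsv : s = v := (quotient_remainder_unique (u := U * (q + q) + k) (u' := u) hs
      (hv.trans_le le_self_add) (by rw [← hc, hU, hq]; ring)).2
    subst hsv
    have h1 : s + p z < p z + p z := by gcongr
    have h2 : k + 1 ≤ q + q := by
      rw [Model.add_one_le_iff]
      by_contra hk
      rw [not_lt] at hk
      have : p z' + p z' ≤ k * (p z + p z) + s := by
        rw [hq, ← add_mul]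
        exact (mul_le_mul_left hk _).trans le_self_add
      exact hr.not_ge this
    have h3 : k * (p z + p z) + s + p z < p z' + p z' := by
      calc k * (p z + p z) + s + p z < k * (p z + p z) + (p z + p z) := by
            rw [add_assoc]
            gcongr
        _ = (k + 1) * (p z + p z) := by ring
        _ ≤ (q + q) * (p z + p z) := mul_le_mul_left h2 _
        _ = p z' + p z' := by rw [hq]; ring
    rw [bit_iff hr hU, bit_iff h3 (by rw [hU]; ring)]
    refine ⟨fun h4 => ?_, fun h4 => h4.trans le_self_add⟩
    have : q ≤ k := quotient_lt_of_lt (v' := 0) h1 (by rw [add_zero, ← hq, ← add_assoc]; exact h4)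
    rw [hq]
    exact (mul_le_mul_left this _).trans le_self_add
  · obtain ⟨q, hq⟩ := hp.exists_eq_mul_of_lt h
    rw [bit_iff hr hU, bit_iff (u := U + q) hr (by rw [hU, hq]; ring)]

theorem exists_code (hp : IsPowTwo p) {R : T.S.M → Prop} (hR : Dec (fun x => R (x 0)))
    (a : T.S.M) : ∃ c, ∀ z < a, (Bit p z c ↔ R z) := by
  refine Sig.induction (P := fun a => ∃ c, ∀ z < a, (Bit p z c ↔ R z))
    (.ex (Dec.ball (.var 1) (.iff (hp.dec_bit.app₂ (.var 0) (.var 1))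
      (hR.subst fun _ => .var 0))).1) ⟨0, fun z hz => absurd hz not_lt_zero⟩ ?_ a
  rintro a ⟨c, hc⟩
  suffices ∃ c', (Bit p a c' ↔ R a) ∧ ∀ z, a ≠ z → (Bit p z c' ↔ Bit p z c) by
    obtain ⟨c', h1, h2⟩ := this
    refine ⟨c', fun z hz => ?_⟩
    rcases (Model.lt_add_one_iff.1 hz).lt_or_eq with hz | rfl
    · exact (h2 z hz.ne').trans (hc z hz)
    · exact h1
  by_cases hB : Bit p a c <;> by_cases hRa : R a
  · exact ⟨c, by tauto, by tauto⟩
  · obtain ⟨u, v, hv, rfl⟩ := hB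
    refine ⟨u * (p a + p a) + v, ?_, fun z hz => ?_⟩
    · rw [bit_iff (hv.trans_le le_self_add) rfl]
      exact iff_of_false hv.not_ge hRa
    · rw [← hp.bit_add_iff hz hv rfl, add_right_comm]
  · obtain ⟨u, r, hr, hU⟩ := exists_quotient_remainder (hp.add_pos a) c
    rw [bit_iff hr hU, not_le] at hB
    refine ⟨c + p a, iff_of_true ⟨u, r, hB, by rw [hU]; ring⟩ hRa, fun z hz => ?_⟩
    exact hp.bit_add_iff hz hB hU
  · exact ⟨c, by tauto, by tauto⟩

end IsPowTwo

/-- Every cofinal set in the second-order part can be thinned out so that, below `a`, each section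
of a given `Σ₁⁰` relation either contains the set or meets it in a bounded set, and which of these
happens is coded by a number. -/
theorem exists_cofinal_decide {p : T.S.M → T.S.M} (hp : IsPowTwo p) {R : T.S.M → T.S.M → Prop}
    (hR : Sig (fun x => R (x 0) (x 1))) (a : T.S.M) {A : Set T.S.M} (hA : A ∈ T.X)
    (hcof : Cofinal T.S A) : ∃ B ∈ T.X, Cofinal T.S B ∧ B ⊆ A ∧ ∃ c, ∀ z < a,
      (Bit p z c → ∀ i ∈ B, R i z) ∧ (¬ Bit p z c → ∃ b, ∀ i ∈ B, R i z → i ≤ b) := by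
  obtain ⟨N, hN⟩ := hp.exists_code (R := fun _ => True)
    ((Bdd.eq (.const (0 : T.S.M)) (.const 0)).dec.congr fun _ => by simp) a
  have hS : Sig (fun x => x 1 ∈ A ∧ ∀ z < a, Bit p z (x 0) ∨ R (x 1) z) :=
    .and (Bdd.mem (.var 1) hA).sig (.ball (Q := fun z x => Bit p z (x 0) ∨ R (x 1) z) (.const a)
      (.or (hp.dec_bit.app₂ (.var 0) (.var 1)).1 (hR.app₂ (.var 2) (.var 0))))
  obtain ⟨d, hd, b, hb⟩ := Sig.exists_least_cofinal
    (P := fun n i => i ∈ A ∧ ∀ z < a, Bit p z n ∨ R i z) hS (N := N + 1) fun b => by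
      obtain ⟨i, hi, hbi⟩ := hcof b
      exact ⟨i, hbi, N, Model.lt_add_one_iff.2 le_rfl, hi, fun z hz => Or.inl ((hN z hz).2 trivial)⟩
  obtain ⟨B, hB, hBc, hBS⟩ := Sig.exists_cofinal_subset
    (P := fun i => i ∈ A ∧ ∀ z < a, Bit p z d ∨ R i z) (hS.app₂
      (R := fun n i => i ∈ A ∧ ∀ z < a, Bit p z n ∨ R i z) (.const d) (.var 0)) hd
  obtain ⟨c, hc⟩ := hp.exists_code (R := fun z => ¬ Bit p z d)
    (hp.dec_bit.app₂ (.var 0) (.const d)).not a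
  refine ⟨B, hB, hBc, fun i hi => (hBS i hi).1, c, fun z hz => ⟨fun h i hi => ?_, fun h => ?_⟩⟩
  · exact ((hBS i hi).2 z hz).resolve_left ((hc z hz).1 h)
  · rw [hc z hz, not_not] at h
    obtain ⟨u, v, hv, rfl⟩ := h
    refine ⟨b, fun i hi hiz => ?_⟩
    by_contra hlt
    rw [not_le] at hlt
    refine hb i hlt (u * (p z + p z) + v) ?_ ⟨(hBS i hi).1, fun z' hz' => ?_⟩
    · rw [add_right_comm]
      exact lt_add_of_pos_right _ (hp.pos z)
    · rcases eq_or_ne z z' with rfl | hne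
      · exact Or.inr hiz
      · refine ((hBS i hi).2 z' hz').imp_left fun h => ?_
        rw [add_right_comm, hp.bit_add_iff hne hv rfl] at h
        exact h

end Digits

/-! ## A generic filter of cofinal sets -/

section Generic

variable {T : Model}

theorem Rep.unique {φ : Fml} {P Q : (ℕ → T.S.M) → Prop} (h : Rep φ P) (h' : Rep φ Q) : P = Q :=
  funext fun x => propext ((h x x).trans (h' x x).symm)

instance : Countable T.S.M := T.num_surjective.countable

theorem countable_sig : {P : (ℕ → T.S.M) → Prop | Sig P}.Countable := by
  have hφ : ∀ P : {P : (ℕ → T.S.M) → Prop | Sig P}, ∃ φ, Rep φ P.1 := fun P => by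
    obtain ⟨φ, -, h⟩ := P.2.rep
    exact ⟨φ, h⟩
  choose F hF using hφ
  have : Function.Injective F := fun P Q hPQ => Subtype.ext ((hF P).unique (hPQ ▸ hF Q))
  exact this.countable

theorem countable_fn : {f : T.S.M → T.S.M | Fn (fun x => f (x 0))}.Countable := by
  refine (countable_sig (T := T)).preimage_of_injOn
    (f := fun f : T.S.M → T.S.M => fun x : ℕ → T.S.M => x 0 = f (x 1)) ?_
  intro f _ g _ hfg
  funext a
  have := congrFun hfg (push (f a) fun _ => a)
  exact (iff_of_eq this).1 rfl

theorem countable_sig₂ :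
    {R : T.S.M → T.S.M → Prop | Sig (fun x => R (x 0) (x 1))}.Countable := by
  refine (countable_sig (T := T)).preimage_of_injOn
    (f := fun R : T.S.M → T.S.M → Prop => fun x : ℕ → T.S.M => R (x 0) (x 1)) ?_
  intro R _ R' _ h
  funext a b
  exact congrFun h (push a fun _ => b)

theorem exists_generic {𝒟 : Set (Set (Set T.S.M))} (h𝒟 : 𝒟.Countable)
    (hd : ∀ D ∈ 𝒟, ∀ A ∈ T.X, Cofinal T.S A → ∃ B ∈ T.X, Cofinal T.S B ∧ B ⊆ A ∧ B ∈ D) :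
    ∃ U : Filter T.S.M,
      (∀ A ∈ U, ∃ B ∈ U, B ∈ T.X ∧ Cofinal T.S B ∧ B ⊆ A) ∧ ∀ D ∈ 𝒟, ∃ B ∈ U, B ∈ D := by
  have huniv : (Set.univ : Set T.S.M) ∈ T.X := by
    have := (Bdd.eq (T := T) (.var 0) (.var 0)).dec
    convert Sig.setOf_mem (T := T) (P := fun m => m = m) this.1 this.2
    ext; simp
  have hcof : Cofinal T.S Set.univ := fun b =>
    ⟨b + 1, trivial, show b < b + 1 from Model.lt_add_one_iff.2 le_rfl⟩
  rcases 𝒟.eq_empty_or_nonempty with rfl | hne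
  · exact ⟨⊤, fun A hA => ⟨_, Filter.univ_mem, huniv, hcof, (Filter.mem_top.1 hA).ge⟩, by simp⟩
  obtain ⟨D, rfl⟩ := h𝒟.exists_eq_range hne
  have hstep : ∀ n (A : {A // A ∈ T.X ∧ Cofinal T.S A}),
      ∃ B : {A // A ∈ T.X ∧ Cofinal T.S A}, B.1 ⊆ A.1 ∧ B.1 ∈ D n := fun n A => by
    obtain ⟨B, h1, h2, h3⟩ := hd _ ⟨n, rfl⟩ A.1 A.2.1 A.2.2
    exact ⟨⟨B, h1, h2⟩, h3⟩
  choose next hsub hmem using hstep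
  let A : ℕ → {A // A ∈ T.X ∧ Cofinal T.S A} := fun n => Nat.rec ⟨_, huniv, hcof⟩ next n
  have hanti : Antitone fun n => (A n).1 := antitone_nat_of_succ_le fun n => hsub n (A n)
  have hbasis := Filter.hasBasis_iInf_principal (s := fun n => (A n).1)
    (directed_of_isDirected_le hanti)
  refine ⟨⨅ n, Filter.principal (A n).1, fun B hB => ?_, ?_⟩
  · obtain ⟨n, -, hn⟩ := hbasis.mem_iff.1 hB
    exact ⟨(A n).1, hbasis.mem_of_mem trivial, (A n).2.1, (A n).2.2, hn⟩
  · rintro _ ⟨n, rfl⟩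
    exact ⟨(A (n + 1)).1, hbasis.mem_of_mem (i := n + 1) trivial, hmem n (A n)⟩

/-- A filter of cofinal sets which decides the sets in the second-order part, the values of bounded
computable functions, and the bounded parts of `Σ₁⁰` relations. -/
structure IsGeneric (U : Filter T.S.M) : Prop where
  exists_subset : ∀ A ∈ U, ∃ B ∈ U, B ∈ T.X ∧ Cofinal T.S B ∧ B ⊆ A
  mem_or_compl_mem : ∀ A ∈ T.X, A ∈ U ∨ Aᶜ ∈ U
  eventually_le_or_eq : ∀ f : T.S.M → T.S.M, Fn (fun x => f (x 0)) → ∀ a,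
    (∀ᶠ i in U, a ≤ f i) ∨ ∃ k, ∀ᶠ i in U, f i = k
  exists_bit_iff : ∀ p : T.S.M → T.S.M, IsPowTwo p → ∀ R : T.S.M → T.S.M → Prop,
    Sig (fun x => R (x 0) (x 1)) → ∀ a, ∃ c, ∀ z < a, (Bit p z c ↔ ∀ᶠ i in U, R i z)

theorem Cofinal.of_dec {A : Set T.S.M} (hA : A ∈ T.X) {P : T.S.M → Prop}
    (hP : Dec (fun x => P (x 0))) (hcof : ∀ b, ∃ i, b < i ∧ i ∈ A ∧ P i) :
    ∃ B ∈ T.X, Cofinal T.S B ∧ B ⊆ A ∧ ∀ i ∈ B, P i := by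
  have := (Bdd.mem (T := T) (.var 0) hA).dec.and hP
  obtain ⟨B, hB, hBc, h⟩ := Sig.exists_cofinal_subset (P := fun i => i ∈ A ∧ P i) this.1 hcof
  exact ⟨B, hB, hBc, fun i hi => (h i hi).1, fun i hi => (h i hi).2⟩

theorem exists_cofinal_subset_or_compl {A B : Set T.S.M} (hA : A ∈ T.X) (hB : B ∈ T.X)
    (hB' : Cofinal T.S B) : ∃ C ∈ T.X, Cofinal T.S C ∧ C ⊆ B ∧ (C ⊆ A ∨ C ⊆ Aᶜ) := by
  have hdec := (Bdd.mem (T := T) (.var 0) hA).dec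
  by_cases h : ∀ b, ∃ i, b < i ∧ i ∈ B ∧ i ∈ A
  · obtain ⟨C, h1, h2, h3, h4⟩ := Cofinal.of_dec hB (P := fun i => i ∈ A) hdec h
    exact ⟨C, h1, h2, h3, .inl h4⟩
  · push Not at h
    obtain ⟨b, hb⟩ := h
    obtain ⟨C, h1, h2, h3, h4⟩ := Cofinal.of_dec hB (P := fun i => i ∉ A) hdec.not fun b' => by
      obtain ⟨i, hi, hlt⟩ := hB' (max b b')
      have hlt : max b b' < i := hlt
      exact ⟨i, (le_max_right _ _).trans_lt hlt, hi, hb i ((le_max_left _ _).trans_lt hlt) hi⟩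
    exact ⟨C, h1, h2, h3, .inr h4⟩

theorem exists_cofinal_subset_le_or_eq {f : T.S.M → T.S.M} (hf : Fn (fun x => f (x 0)))
    (a : T.S.M) {B : Set T.S.M} (hB : B ∈ T.X) (hB' : Cofinal T.S B) :
    ∃ C ∈ T.X, Cofinal T.S C ∧ C ⊆ B ∧ ((∀ i ∈ C, a ≤ f i) ∨ ∃ k, ∀ i ∈ C, f i = k) := by
  by_cases h : ∀ b, ∃ i, b < i ∧ i ∈ B ∧ f i < a
  · have hdec : Dec (fun x => x 1 ∈ B ∧ f (x 1) = x 0) :=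
      .and (Bdd.mem (.var 1) hB).dec (.eq (hf.app (.var 1)) (.var 0))
    obtain ⟨k, hk, -⟩ := Sig.exists_least_cofinal (P := fun n i => i ∈ B ∧ f i = n) hdec.1
      (N := a) fun b => by
        obtain ⟨i, h1, h2, h3⟩ := h b
        exact ⟨i, h1, f i, h3, h2, rfl⟩
    obtain ⟨C, h1, h2, h3, h4⟩ := Cofinal.of_dec hB (P := fun i => f i = k)
      (.eq hf (.const k)) hk
    exact ⟨C, h1, h2, h3, .inr ⟨k, h4⟩⟩
  · push Not at h
    obtain ⟨b, hb⟩ := h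
    obtain ⟨C, h1, h2, h3, h4⟩ := Cofinal.of_dec hB (P := fun i => ¬ f i < a)
      (Dec.lt hf (.const a)).not fun b' => by
      obtain ⟨i, hi, hlt⟩ := hB' (max b b')
      have hlt : max b b' < i := hlt
      exact ⟨i, (le_max_right _ _).trans_lt hlt, hi,
        (hb i ((le_max_left _ _).trans_lt hlt) hi).not_gt⟩
    exact ⟨C, h1, h2, h3, .inl fun i hi => not_lt.1 (h4 i hi)⟩

theorem exists_isGeneric (T : Model) : ∃ U : Filter T.S.M, IsGeneric U := by
  have hX : Countable T.X := by
    have : Function.Surjective fun i => (⟨T.sets i, T.sets_mem i⟩ : T.X) := fun A => by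
      obtain ⟨i, hi⟩ := T.sets_surjective _ A.2
      exact ⟨i, Subtype.ext hi⟩
    exact this.countable
  have hfn := (countable_fn (T := T)).to_subtype
  have hsig := (countable_sig₂ (T := T)).to_subtype
  have hpow : Countable {p : T.S.M → T.S.M | IsPowTwo p} :=
    (countable_fn.mono fun p hp => hp.fn).to_subtype
  let D₁ : T.X → Set (Set T.S.M) := fun A => {C | C ⊆ A ∨ C ⊆ A.1ᶜ}
  let D₂ : {f : T.S.M → T.S.M | Fn (fun x => f (x 0))} × T.S.M → Set (Set T.S.M) :=
    fun q => {C | (∀ i ∈ C, q.2 ≤ q.1.1 i) ∨ ∃ k, ∀ i ∈ C, q.1.1 i = k}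
  let D₃ : {p : T.S.M → T.S.M | IsPowTwo p} ×
      {R : T.S.M → T.S.M → Prop | Sig (fun x => R (x 0) (x 1))} × T.S.M → Set (Set T.S.M) :=
    fun q => {C | ∃ c, ∀ z < q.2.2, (Bit q.1.1 z c → ∀ i ∈ C, q.2.1.1 i z) ∧
      (¬ Bit q.1.1 z c → ∃ b, ∀ i ∈ C, q.2.1.1 i z → i ≤ b)}
  obtain ⟨U, hU, hD⟩ := exists_generic (T := T)
    (𝒟 := Set.range D₁ ∪ (Set.range D₂ ∪ Set.range D₃))
    ((Set.countable_range _).union ((Set.countable_range _).union (Set.countable_range _))) (by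
      rintro D (⟨A, rfl⟩ | ⟨q, rfl⟩ | ⟨q, rfl⟩) B hB hB'
      · exact exists_cofinal_subset_or_compl A.2 hB hB'
      · exact exists_cofinal_subset_le_or_eq q.1.2 q.2 hB hB'
      · exact exists_cofinal_decide q.1.2 q.2.1.2 q.2.2 hB hB')
  refine ⟨U, hU, fun A hA => ?_, fun f hf a => ?_, fun p hp R hR a => ?_⟩
  · obtain ⟨B, hB, hBD⟩ := hD (D₁ ⟨A, hA⟩) (.inl ⟨_, rfl⟩)
    exact hBD.imp (Filter.mem_of_superset hB) (Filter.mem_of_superset hB)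
  · obtain ⟨B, hB, hBD⟩ := hD (D₂ ⟨⟨f, hf⟩, a⟩) (.inr (.inl ⟨_, rfl⟩))
    exact hBD.imp (Filter.mem_of_superset hB) fun ⟨k, hk⟩ => ⟨k, Filter.mem_of_superset hB hk⟩
  · obtain ⟨B, hB, c, hc⟩ := hD (D₃ ⟨⟨p, hp⟩, ⟨R, hR⟩, a⟩) (.inr (.inr ⟨_, rfl⟩))
    refine ⟨c, fun z hz => ⟨fun h => Filter.mem_of_superset hB ((hc z hz).1 h), fun h => ?_⟩⟩
    by_contra hbit
    obtain ⟨b, hb⟩ := (hc z hz).2 hbit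
    obtain ⟨C, -, -, hC, hsub⟩ := hU _ (Filter.inter_mem hB h)
    obtain ⟨i, hi, hlt⟩ := hC b
    have hlt : b < i := hlt
    exact hlt.not_ge (hb i (hsub hi).1 (hsub hi).2)

end Generic

/-! ## The restricted ultrapower of computable functions -/

section Ultrapower

variable {T : Model}

/-- The unary computable functions. -/
abbrev Fun (T : Model) : Type := {f : T.S.M → T.S.M // Fn (fun x => f (x 0))}

/-- Equality of computable functions modulo a filter. -/
def eventuallyEqSetoid (U : Filter T.S.M) : Setoid (Fun T) where
  r f g := ∀ᶠ i in U, f.1 i = g.1 i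
  iseqv :=
    { refl := fun _ => .of_forall fun _ => rfl
      symm := fun h => h.mono fun _ => Eq.symm
      trans := fun h h' => (h.and h').mono fun _ hi => hi.1.trans hi.2 }

/-- The constant function. -/
def constFun (a : T.S.M) : Fun T := ⟨fun _ => a, .const a⟩

/-- The ultrapower of a model restricted to computable functions. -/
def ultrapower (U : Filter T.S.M) : Str where
  M := Quotient (eventuallyEqSetoid U)
  zero := ⟦constFun 0⟧
  one := ⟦constFun 1⟧
  add := Quotient.map₂ (fun f g => ⟨fun i => f.1 i + g.1 i, f.2.add g.2⟩)
    fun _ _ h _ _ h' => (h.and h').mono fun _ hi => congrArg₂ (· + ·) hi.1 hi.2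
  mul := Quotient.map₂ (fun f g => ⟨fun i => f.1 i * g.1 i, f.2.mul g.2⟩)
    fun _ _ h _ _ h' => (h.and h').mono fun _ hi => congrArg₂ (· * ·) hi.1 hi.2
  lt := Quotient.lift₂ (fun f g => ∀ᶠ i in U, f.1 i < g.1 i)
    fun _ _ _ _ h h' => propext <| Filter.eventually_congr <| (h.and h').mono fun _ hi => by
      rw [hi.1, hi.2]

/-- The class of a computable function in the ultrapower. -/
def cls (U : Filter T.S.M) (f : Fun T) : (ultrapower U).M := Quotient.mk (eventuallyEqSetoid U) f

/-- The subset of the ultrapower induced by a set. -/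
def setImage (U : Filter T.S.M) (A : Set T.S.M) : Set (ultrapower U).M :=
  {b | Quotient.lift (fun f : Fun T => ∀ᶠ i in U, f.1 i ∈ A)
    (fun _ _ (h : ∀ᶠ i in U, _ = _) =>
      propext <| Filter.eventually_congr <| h.mono fun _ hi => by rw [hi]) b}

variable {U : Filter T.S.M}

theorem cls_eq_iff {f g : Fun T} : cls U f = cls U g ↔ ∀ᶠ i in U, f.1 i = g.1 i :=
  Quotient.eq (r := eventuallyEqSetoid U)

theorem exists_cls_eq (b : (ultrapower U).M) : ∃ f, cls U f = b :=
  Quotient.exists_rep b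

theorem cls_lt_iff {f g : Fun T} :
    (ultrapower U).lt (cls U f) (cls U g) ↔ ∀ᶠ i in U, f.1 i < g.1 i := Iff.rfl

theorem cls_mem_setImage {f : Fun T} {A : Set T.S.M} :
    cls U f ∈ setImage U A ↔ ∀ᶠ i in U, f.1 i ∈ A := Iff.rfl

theorem tval_cls (f : ℕ → Fun T) (τ : Term) : tval (ultrapower U) (fun k => cls U (f k)) τ =
    cls U ⟨fun i => tval T.S (fun k => (f k).1 i) τ, Fn.tval (fun k => (f k).2) τ⟩ := by
  induction τ with
  | var | zero | one => rfl
  | add s t hs ht =>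
    rw [tval, hs, ht]
    rfl
  | mul s t hs ht =>
    rw [tval, hs, ht]
    rfl

theorem upd_cls (f : ℕ → Fun T) (y : ℕ) (g : Fun T) :
    upd (fun k => cls U (f k)) y (cls U g) = fun k => cls U (upd f y g k) := by
  funext k
  unfold upd
  split_ifs <;> rfl

theorem upd_apply (f : ℕ → Fun T) (y : ℕ) (g : Fun T) (i : T.S.M) :
    (fun k => (upd f y g k).1 i) = upd (fun k => (f k).1 i) y (g.1 i) := by
  funext k
  unfold upd
  split_ifs <;> rfl

theorem Fn.upd (f : ℕ → Fun T) (y k : ℕ) :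
    Fn (fun x => if k = y then x 1 else (f k).1 (x 0)) := by
  split_ifs
  · exact .var 1
  · exact (f k).2

theorem Delta0SO.dec_sat_fun {φ : Fml} (hφ : Delta0SO φ) {w : ℕ → Set T.S.M}
    (hw : ∀ i, w i ∈ T.X) (f : ℕ → Fun T) :
    Dec (fun x => Sat T.S T.X (fun k => (f k).1 (x 0)) w φ) :=
  hφ.dec_sat hw (f := fun k x => (f k).1 (x 0)) fun k => (f k).2

namespace IsGeneric

theorem neBot (hU : IsGeneric U) : U.NeBot := by
  refine ⟨fun h => ?_⟩
  obtain ⟨B, -, -, hB, hsub⟩ := hU.exists_subset ∅ (by rw [h]; trivial)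
  obtain ⟨i, hi, -⟩ := hB 0
  exact hsub hi

theorem not_eventually (hU : IsGeneric U) {P : T.S.M → Prop} (hP : Dec (fun x => P (x 0))) :
    (¬ ∀ᶠ i in U, P i) ↔ ∀ᶠ i in U, ¬ P i := by
  have := hU.neBot
  refine ⟨(hU.mem_or_compl_mem _ (Sig.setOf_mem hP.1 hP.2)).resolve_left, fun h h' => ?_⟩
  obtain ⟨i, hi, hi'⟩ := (h.and h').exists
  exact hi hi'

theorem eventually_imp (hU : IsGeneric U) {P Q : T.S.M → Prop} (hP : Dec (fun x => P (x 0))) :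
    (∀ᶠ i in U, P i → Q i) ↔ ((∀ᶠ i in U, P i) → ∀ᶠ i in U, Q i) := by
  refine ⟨fun h h' => Filter.Eventually.mp h' h, fun h => ?_⟩
  by_cases h' : ∀ᶠ i in U, P i
  · exact (h h').mono fun _ hi _ => hi
  · exact ((hU.not_eventually hP).1 h').mono fun _ hi hi' => absurd hi' hi

theorem eventually_or (hU : IsGeneric U) {P Q : T.S.M → Prop} (hP : Dec (fun x => P (x 0))) :
    (∀ᶠ i in U, P i ∨ Q i) ↔ ((∀ᶠ i in U, P i) ∨ ∀ᶠ i in U, Q i) := by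
  simp only [or_iff_not_imp_left, hU.eventually_imp (P := fun i => ¬ P i) hP.not,
    hU.not_eventually hP]

theorem eventually_exists (hU : IsGeneric U) {R : T.S.M → T.S.M → Prop}
    (hR : Sig (fun x => R (x 0) (x 1))) :
    (∀ᶠ i in U, ∃ m, R i m) ↔ ∃ g : Fun T, ∀ᶠ i in U, R i (g.1 i) := by
  refine ⟨fun h => ?_, fun ⟨g, hg⟩ => hg.mono fun i hi => ⟨_, hi⟩⟩
  obtain ⟨B, hBU, hB, -, hsub⟩ := hU.exists_subset _ h
  obtain ⟨f, hf, hfR⟩ := Sig.select (R := fun i m => i ∉ B ∨ R i m)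
    (.or (Bdd.mem (.var 0) hB).not.sig hR) fun i => by
      by_cases hi : i ∈ B
      · exact (hsub hi).imp fun _ => Or.inr
      · exact ⟨0, .inl hi⟩
  exact ⟨⟨f, hf⟩, Filter.mem_of_superset hBU fun i hi => (hfR i).resolve_left (not_not.2 hi)⟩

/-- The theorem of Łoś for bounded formulas. -/
theorem sat_delta0_iff (hU : IsGeneric U) {φ : Fml} (hφ : Delta0SO φ) (f : ℕ → Fun T)
    {w : ℕ → Set T.S.M} (hw : ∀ i, w i ∈ T.X) (Y : Set (Set (ultrapower U).M)) :
    Sat (ultrapower U) Y (fun k => cls U (f k)) (fun k => setImage U (w k)) φ ↔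
      ∀ᶠ i in U, Sat T.S T.X (fun k => (f k).1 i) w φ := by
  induction hφ generalizing f with
  | eq s t =>
    simp only [Sat, tval_cls]
    exact cls_eq_iff
  | lt s t =>
    simp only [Sat, tval_cls]
    exact cls_lt_iff
  | mem t j =>
    simp only [Sat, tval_cls]
    exact cls_mem_setImage
  | not h ih =>
    simp only [Sat, ih]
    exact hU.not_eventually (h.dec_sat_fun hw f)
  | and h h' ih ih' => simp only [Sat, ih, ih', Filter.eventually_and]
  | or h h' ih ih' =>
    simp only [Sat, ih, ih']
    exact (hU.eventually_or (h.dec_sat_fun hw f)).symm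
  | imp h h' ih ih' =>
    simp only [Sat, ih, ih']
    exact (hU.eventually_imp (h.dec_sat_fun hw f)).symm
  | ball y t h ih =>
    rename_i ψ
    simp only [Sat, tval_cls]
    constructor
    · intro H
      by_contra hcon
      rw [hU.not_eventually ((h.ball y t).dec_sat_fun hw f)] at hcon
      obtain ⟨g, hg⟩ := (hU.eventually_exists (R := fun i m =>
        m < tval T.S (fun k => (f k).1 i) t ∧ ¬ Sat T.S T.X (upd (fun k => (f k).1 i) y m) w ψ)
        (Dec.and (.lt (.var 1) (Fn.tval (f := fun k x => (f k).1 (x 0)) (fun k => (f k).2) t))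
          (h.dec_sat hw (Fn.upd f y)).not).1).1 (hcon.mono fun i hi => by
            by_contra h'
            push Not at h'
            exact hi h')
      have hsat := H (cls U g) (cls_lt_iff.2 (hg.mono fun i hi => hi.1))
      rw [upd_cls, ih] at hsat
      have := hU.neBot
      obtain ⟨i, hi, hi'⟩ := (hsat.and hg).exists
      rw [upd_apply] at hi
      exact hi'.2 hi
    · intro H m hm
      obtain ⟨g, rfl⟩ := exists_cls_eq m
      rw [upd_cls, ih]
      filter_upwards [H, cls_lt_iff.1 hm] with i hi hi'
      rw [upd_apply]
      exact hi _ hi'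
  | bex y t h ih =>
    rename_i ψ
    simp only [Sat, tval_cls]
    refine Iff.trans ?_ (hU.eventually_exists (R := fun i m =>
        m < tval T.S (fun k => (f k).1 i) t ∧ Sat T.S T.X (upd (fun k => (f k).1 i) y m) w ψ)
        (Dec.and (.lt (.var 1) (Fn.tval (f := fun k x => (f k).1 (x 0)) (fun k => (f k).2) t))
          (h.dec_sat hw (Fn.upd f y))).1).symm
    constructor
    · rintro ⟨m, hm, hsat⟩
      obtain ⟨g, rfl⟩ := exists_cls_eq m
      rw [upd_cls, ih] at hsat
      refine ⟨g, (cls_lt_iff.1 hm).and (hsat.mono fun i hi => ?_)⟩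
      rw [upd_apply] at hi
      exact hi
    · rintro ⟨g, hg⟩
      refine ⟨cls U g, cls_lt_iff.2 (hg.mono fun i hi => hi.1), ?_⟩
      rw [upd_cls, ih]
      refine hg.mono fun i hi => ?_
      rw [upd_apply]
      exact hi.2

/-- The theorem of Łoś for `Σ₁⁰` formulas. -/
theorem sat_sigma_iff (hU : IsGeneric U) {φ : Fml} (hφ : SigmaSO 1 φ) (f : ℕ → Fun T)
    {w : ℕ → Set T.S.M} (hw : ∀ i, w i ∈ T.X) (Y : Set (Set (ultrapower U).M)) :
    Sat (ultrapower U) Y (fun k => cls U (f k)) (fun k => setImage U (w k)) φ ↔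
      ∀ᶠ i in U, Sat T.S T.X (fun k => (f k).1 i) w φ := by
  induction φ generalizing f with
  | ex y φ ih =>
    cases hφ with
    | delta0 h => exact hU.sat_delta0_iff h f hw Y
    | ofPi h => cases h with | delta0 h => exact hU.sat_delta0_iff h f hw Y
    | ex _ h =>
      simp only [Sat]
      rw [hU.eventually_exists (R := fun i m => Sat T.S T.X (upd (fun k => (f k).1 i) y m) w φ)
        (h.sig_sat hw (Fn.upd f y))]
      constructor
      · rintro ⟨m, hm⟩
        obtain ⟨g, rfl⟩ := exists_cls_eq m
        rw [upd_cls, ih h] at hm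
        refine ⟨g, hm.mono fun i hi => ?_⟩
        rw [upd_apply] at hi
        exact hi
      · rintro ⟨g, hg⟩
        refine ⟨cls U g, ?_⟩
        rw [upd_cls, ih h]
        refine hg.mono fun i hi => ?_
        rw [upd_apply]
        exact hi
  | _ =>
    cases hφ with
    | delta0 h => exact hU.sat_delta0_iff h f hw Y
    | ofPi h => cases h with | delta0 h => exact hU.sat_delta0_iff h f hw Y

theorem sat_delta0_iff_frequently (hU : IsGeneric U) {φ : Fml} (hφ : Delta0SO φ) (f : ℕ → Fun T)
    {w : ℕ → Set T.S.M} (hw : ∀ i, w i ∈ T.X) (Y : Set (Set (ultrapower U).M)) :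
    Sat (ultrapower U) Y (fun k => cls U (f k)) (fun k => setImage U (w k)) φ ↔
      ∃ᶠ i in U, Sat T.S T.X (fun k => (f k).1 i) w φ := by
  rw [hU.sat_delta0_iff hφ f hw Y, Filter.Frequently, ← hU.not_eventually (hφ.dec_sat_fun hw f),
    not_not]

/-- The theorem of Łoś for `Π₁⁰` formulas. -/
theorem sat_pi_iff (hU : IsGeneric U) {φ : Fml} (hφ : PiSO 1 φ) (f : ℕ → Fun T)
    {w : ℕ → Set T.S.M} (hw : ∀ i, w i ∈ T.X) (Y : Set (Set (ultrapower U).M)) :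
    Sat (ultrapower U) Y (fun k => cls U (f k)) (fun k => setImage U (w k)) φ ↔
      ∃ᶠ i in U, Sat T.S T.X (fun k => (f k).1 i) w φ := by
  induction φ generalizing f with
  | all y φ ih =>
    cases hφ with
    | delta0 h => exact hU.sat_delta0_iff_frequently h f hw Y
    | ofSigma h => cases h with | delta0 h => exact hU.sat_delta0_iff_frequently h f hw Y
    | all _ h =>
      rw [Filter.Frequently, ← not_iff_not, not_not]
      simp only [Sat, not_forall]
      rw [hU.eventually_exists (R := fun i m => ¬ Sat T.S T.X (upd (fun k => (f k).1 i) y m) w φ)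
        (h.sig_not_sat hw (Fn.upd f y))]
      constructor
      · rintro ⟨m, hm⟩
        obtain ⟨g, rfl⟩ := exists_cls_eq m
        rw [upd_cls, ih h, Filter.not_frequently] at hm
        refine ⟨g, hm.mono fun i hi => ?_⟩
        rw [upd_apply] at hi
        exact hi
      · rintro ⟨g, hg⟩
        refine ⟨cls U g, ?_⟩
        rw [upd_cls, ih h, Filter.not_frequently]
        refine hg.mono fun i hi => ?_
        rw [upd_apply]
        exact hi
  | _ =>
    cases hφ with
    | delta0 h => exact hU.sat_delta0_iff_frequently h f hw Y
    | ofSigma h => cases h with | delta0 h => exact hU.sat_delta0_iff_frequently h f hw Y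

theorem frequently_of_sat (hU : IsGeneric U) {φ : Fml} (hφ : SigmaSO 2 φ) (f : ℕ → Fun T)
    {w : ℕ → Set T.S.M} (hw : ∀ i, w i ∈ T.X) (Y : Set (Set (ultrapower U).M))
    (hsat : Sat (ultrapower U) Y (fun k => cls U (f k)) (fun k => setImage U (w k)) φ) :
    ∃ᶠ i in U, Sat T.S T.X (fun k => (f k).1 i) w φ := by
  induction φ generalizing f with
  | ex y φ ih =>
    cases hφ with
    | delta0 h => exact (hU.sat_pi_iff (.delta0 h) f hw Y).1 hsat
    | ofPi h => exact (hU.sat_pi_iff h f hw Y).1 hsat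
    | ex _ h =>
      obtain ⟨m, hm⟩ := hsat
      obtain ⟨g, rfl⟩ := exists_cls_eq m
      rw [upd_cls] at hm
      refine (ih h _ hm).mono fun i hi => ?_
      rw [upd_apply] at hi
      exact ⟨_, hi⟩
  | _ =>
    cases hφ with
    | delta0 h => exact (hU.sat_pi_iff (.delta0 h) f hw Y).1 hsat
    | ofPi h => exact (hU.sat_pi_iff h f hw Y).1 hsat

theorem sat_of_sat (hU : IsGeneric U) {φ : Fml} (hφ : SigmaSO 2 φ) (v : ℕ → T.S.M)
    {w : ℕ → Set T.S.M} (hw : ∀ i, w i ∈ T.X) (Y : Set (Set (ultrapower U).M))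
    (hsat : Sat T.S T.X v w φ) :
    Sat (ultrapower U) Y (fun k => cls U (constFun (v k))) (fun k => setImage U (w k)) φ := by
  have := hU.neBot
  have hpi : ∀ {ψ : Fml} (v : ℕ → T.S.M), PiSO 1 ψ → Sat T.S T.X v w ψ →
      Sat (ultrapower U) Y (fun k => cls U (constFun (v k))) (fun k => setImage U (w k)) ψ :=
    fun v h hsat => (hU.sat_pi_iff h _ hw Y).2 (Filter.Frequently.of_forall fun _ => hsat)
  induction φ generalizing v with
  | ex y φ ih =>
    cases hφ with
    | delta0 h => exact hpi v (.delta0 h) hsat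
    | ofPi h => exact hpi v h hsat
    | ex _ h =>
      obtain ⟨m, hm⟩ := hsat
      refine ⟨cls U (constFun m), ?_⟩
      convert ih h _ hm using 1
      funext k
      unfold upd
      split_ifs <;> rfl
  | _ =>
    cases hφ with
    | delta0 h => exact hpi v (.delta0 h) hsat
    | ofPi h => exact hpi v h hsat

theorem sat_const_iff (hU : IsGeneric U) {φ : Fml} (hφ : SigmaSO 2 φ) (v : ℕ → T.S.M)
    {w : ℕ → Set T.S.M} (hw : ∀ i, w i ∈ T.X) (Y : Set (Set (ultrapower U).M)) :
    Sat T.S T.X v w φ ↔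
      Sat (ultrapower U) Y (fun k => cls U (constFun (v k))) (fun k => setImage U (w k)) φ :=
  ⟨hU.sat_of_sat hφ v hw Y, fun h => (hU.frequently_of_sat hφ _ hw Y h).exists.choose_spec⟩

/-- The embedding of a model into its ultrapower by constant functions. -/
def emb (hU : IsGeneric U) : Emb T.S (ultrapower U) where
  j a := cls U (constFun a)
  inj a b h := by
    have := hU.neBot
    exact Filter.eventually_const.1 (cls_eq_iff.1 h)
  zero := rfl
  one := rfl
  add _ _ := rfl
  mul _ _ := rfl
  lt_iff a b := by
    have := hU.neBot
    exact Filter.eventually_const.symm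

theorem isProper_emb (hU : IsGeneric U) : IsProper hU.emb := by
  intro hsurj
  obtain ⟨a, ha⟩ := hsurj (cls U ⟨fun i => i, .var 0⟩)
  obtain ⟨B, -, -, hB, hsub⟩ := hU.exists_subset _ (cls_eq_iff.1 ha)
  obtain ⟨i, hi, hlt⟩ := hB a
  obtain rfl : a = i := hsub hi
  exact T.pa.lt_irrefl a hlt

theorem isEndExt_emb (hU : IsGeneric U) : IsEndExt hU.emb := by
  intro b hb a
  obtain ⟨f, rfl⟩ := exists_cls_eq b
  rcases hU.eventually_le_or_eq f.1 f.2 (a + 1) with h | ⟨k, hk⟩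
  · exact cls_lt_iff.2 (h.mono fun i hi => Model.add_one_le_iff.1 hi)
  · exact absurd ⟨k, cls_eq_iff.2 (hk.mono fun i hi => Eq.symm hi)⟩ hb

theorem bitVia_emb_iff (hU : IsGeneric U) {E : Fml} (hE : IsExpDef T.S E) {p : T.S.M → T.S.M}
    (hp : ∀ z, ExpAt T.S E (1 + 1) z (p z)) (z c : T.S.M) :
    BitVia hU.emb E (hU.emb.j z) (hU.emb.j c) ↔ Bit p z c := by
  constructor
  · rintro ⟨z', q, hz, hq, u, v, hv, hc⟩
    obtain rfl := hU.emb.inj hz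
    obtain rfl := hE.unique _ _ _ _ (hp z') hq
    obtain ⟨f, rfl⟩ := exists_cls_eq u
    obtain ⟨g, rfl⟩ := exists_cls_eq v
    have := hU.neBot
    obtain ⟨i, hi, hi'⟩ := ((cls_lt_iff.1 hv).and (cls_eq_iff.1 hc)).exists
    exact ⟨f.1 i, g.1 i, hi, hi'⟩
  · rintro ⟨u, v, hv, rfl⟩
    exact ⟨z, p z, rfl, hp z, hU.emb.j u, hU.emb.j v, (hU.emb.lt_iff _ _).1 hv, rfl⟩

theorem exists_bitVia_iff (hU : IsGeneric U) {E : Fml} (hE : IsExpDef T.S E) {φ : Fml}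
    (hφ : SigmaSO 1 φ) (v : ℕ → (ultrapower U).M) {w : ℕ → Set T.S.M} (hw : ∀ k, w k ∈ T.X)
    (Y : Set (Set (ultrapower U).M)) (y : ℕ) (a : T.S.M) :
    ∃ c : (ultrapower U).M, ∀ m, (ultrapower U).lt m (hU.emb.j a) →
      (Sat (ultrapower U) Y (upd v y m) (fun k => setImage U (w k)) φ ↔ BitVia hU.emb E m c) := by
  choose f hf using fun k => exists_cls_eq (v k)
  obtain rfl : (fun k => cls U (f k)) = v := funext hf
  obtain ⟨p, hp, hpE⟩ := hE.exists_isPowTwo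
  obtain ⟨c, hc⟩ := hU.exists_bit_iff p hp
    (fun i m => Sat T.S T.X (upd (fun k => (f k).1 i) y m) w φ) (hφ.sig_sat hw (Fn.upd f y)) a
  refine ⟨hU.emb.j c, fun m hm => ?_⟩
  obtain ⟨z, rfl⟩ : m ∈ Set.range hU.emb.j := by
    by_contra hm'
    obtain ⟨g, rfl⟩ := exists_cls_eq m
    have := hU.neBot
    obtain ⟨i, hi, hi'⟩ := ((cls_lt_iff.1 (hU.isEndExt_emb _ hm' a)).and (cls_lt_iff.1 hm)).exists
    exact lt_asymm hi hi'
  rw [hU.bitVia_emb_iff hE hpE, hc z ((hU.emb.lt_iff _ _).2 hm)]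
  change Sat _ _ (upd _ y (cls U (constFun z))) _ _ ↔ _
  rw [upd_cls, hU.sat_sigma_iff hφ _ hw]
  simp only [upd_apply]
  rfl

end IsGeneric

end Ultrapower

/-! ## An end extension by a single point -/

/-- The extension of a structure by a new largest element. -/
def Str.withTop (S : Str) : Str where
  M := Option S.M
  zero := some S.zero
  one := some S.one
  add
    | some a, some b => some (S.add a b)
    | _, _ => none
  mul
    | some a, some b => some (S.mul a b)
    | _, _ => none
  lt
    | some a, some b => S.lt a b
    | some _, none => True
    | none, _ => False

/-- The embedding of a structure into its extension by a new largest element. -/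
def Str.embWithTop (S : Str) : Emb S S.withTop where
  j := some
  inj := Option.some_injective _
  zero := rfl
  one := rfl
  add _ _ := rfl
  mul _ _ := rfl
  lt_iff _ _ := Iff.rfl

theorem Str.isProper_embWithTop (S : Str) : IsProper S.embWithTop := fun h => by
  obtain ⟨a, ha⟩ := h none
  cases ha

theorem Str.isEndExt_embWithTop (S : Str) : IsEndExt S.embWithTop := by
  rintro (_ | b) hb a
  · trivial
  · exact absurd ⟨b, rfl⟩ hb

theorem ISigmaSO.exists_model {S : Str} {X : Set (Set S.M)} (hcM : Countable S.M)
    (hcX : X.Countable) (hX : X.Nonempty) (h : ISigmaSO S X 2) :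
    ∃ T : Model, (⟨T.S, T.X⟩ : Σ S : Str, Set (Set S.M)) = ⟨S, X⟩ := by
  have : Nonempty S.M := ⟨S.zero⟩
  obtain ⟨num, hnum⟩ := exists_surjective_nat S.M
  obtain ⟨sets, rfl⟩ := hcX.exists_eq_range hX
  exact ⟨⟨S, _, h.1.1, h.1.2.1, h.1.2.2, h.2, num, hnum, sets, fun i => ⟨i, rfl⟩, fun _ => id⟩,
    rfl⟩

/-- Theorem `thm:main-char`.
For every countable model `(M, 𝒳) ⊨ IΣ₂⁰` there is a proper end extension
`(M, 𝒳) ≼_{e,Σ₂⁰} (K, 𝒳)` (same second-order part, injected via `g`) such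
that every `Σ₁⁰`-definable subset of `K` (parameters from `(K, 𝒳)` allowed)
bounded by an element `a ∈ M` is coded by the binary digits of an element
of `K` (digits computed via any `Δ₀` definition `E` of exponentiation on
`M`). -/
theorem statement_10 (S : Str) (X : Set (Set S.M))
    (hcM : Countable S.M) (hcX : X.Countable) (h : ISigmaSO S X 2) :
    ∃ (K : Str) (e : Emb S K) (g : Set S.M → Set K.M),
      IsProper e ∧ IsEndExt e ∧
      (∀ A ∈ X, ∀ a : S.M, (e.j a ∈ g A ↔ a ∈ A)) ∧
      (∀ φ : Fml, SigmaSO 2 φ →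
        ∀ (v : ℕ → S.M) (w : ℕ → Set S.M), (∀ k, w k ∈ X) →
          (Sat S X v w φ ↔
            Sat K (g '' X) (fun k => e.j (v k)) (fun k => g (w k)) φ)) ∧
      (∀ E : Fml, IsExpDef S E →
        ∀ φ : Fml, SigmaSO 1 φ →
          ∀ (v : ℕ → K.M) (w : ℕ → Set K.M), (∀ k, w k ∈ g '' X) →
            ∀ (z : ℕ) (a : S.M),
              ∃ c : K.M, ∀ m : K.M, K.lt m (e.j a) →
                (Sat K (g '' X) (upd v z m) w φ ↔ BitVia e E m c)) := by
  rcases X.eq_empty_or_nonempty with rfl | hX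
  · exact ⟨S.withTop, S.embWithTop, fun _ => ∅, S.isProper_embWithTop, S.isEndExt_embWithTop,
      fun A hA => absurd hA (Set.notMem_empty A), fun φ hφ v w hw => absurd (hw 0) (by simp),
      fun E hE φ hφ v w hw => absurd (hw 0) (by simp)⟩
  · obtain ⟨T, hT⟩ := h.exists_model hcM hcX hX
    cases hT
    obtain ⟨U, hU⟩ := exists_isGeneric T
    have := hU.neBot
    refine ⟨ultrapower U, hU.emb, setImage U, hU.isProper_emb, hU.isEndExt_emb,
      fun A _ a => cls_mem_setImage.trans (Filter.eventually_const (p := a ∈ A)),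
      fun φ hφ v w hw => hU.sat_const_iff hφ v hw _, ?_⟩
    intro E hE φ hφ v w hw z a
    choose w' hw' hww' using hw
    obtain rfl : (fun k => setImage U (w' k)) = w := funext hww'
    exact hU.exists_bitVia_iff hE hφ v hw' _ z a

end PaperArith
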